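/- (Two-parameter flow generated by a Young differential equation.) Assume hypotheses (H1)–(H3) hold on every interval [0,T], T > 0, with all constants independent of T, let q0, q be chosen with 1 − 1/p < 1/q0 < min{β, δα, δ/p, 1/2} and 1/(q0·δ) ≤ 1/q < min{α, 1/p}, let ω ∈ C̃^p(ℝ,ℝ^m), and fix T > 0. For t_1 ≤ t_2 in [0,T] let X(t_1,t_2,ω,·) : ℝ^d → ℝ^d be the Cauchy operator (mapping an initial value at time t_1 to the value at time t_2 of the unique solution of the Young equation dx_t = f(t,x_t)dt + g(t,x_t)dω_t), and for t_1 > t_2 set X(t_1,t_2,ω,·) := X(t_2,t_1,ω,·)^{−1}. Then the family X(s,t,ω,·), s,t ∈ [0,T], is a two-parameter flow of homeomorphisms of ℝ^d on [0,T]: (i) each X(s,t,ω,·) is a homeomorphism of ℝ^d; (ii) X(s,s,ω,·) = id for all s ∈ [0,T]; (iii) X(s,t,ω,·)^{−1} = X(t,s,ω,·) for all s,t ∈ [0,T]; (iv) X(s,t,ω,·) = X(u,t,ω,·) ∘ X(s,u,ω,·) for all s,t,u ∈ [0,T]. Moreover, the map (s,t,z) ↦ X(s,t,ω,z) is continuous.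 -/

import Mathlib

open scoped BigOperators
open Set

noncomputable section

/-- Euclidean space `ℝ^n`. -/
abbrev Ed (n : ℕ) : Type := EuclideanSpace ℝ (Fin n)

section PVarDefs

variable {E F : Type*} [NormedAddCommGroup E] [NormedSpace ℝ E]
  [NormedAddCommGroup F] [NormedSpace ℝ F]

/-- The set of sums `Σ_i ‖x (t (i+1)) - x (t i)‖ ^ p` over all finite partitions
`a = t 0 < t 1 < ⋯ < t n = b` of `[a,b]`. -/
def pVarSums (p : ℝ) (x : ℝ → E) (a b : ℝ) : Set ℝ :=
  { v | ∃ n : ℕ, ∃ t : Fin (n + 1) → ℝ, StrictMono t ∧ t 0 = a ∧ t (Fin.last n) = b ∧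
      v = ∑ i : Fin n, ‖x (t i.succ) - x (t i.castSucc)‖ ^ p }

/-- The `p`-variation seminorm `|||x|||_{p-var,[a,b]}`. -/
def pVar (p : ℝ) (x : ℝ → E) (a b : ℝ) : ℝ :=
  sSup (pVarSums p x a b) ^ (1 / p)

/-- `x` is of finite `p`-variation on `[a,b]`. -/
def FinitePVar (p : ℝ) (x : ℝ → E) (a b : ℝ) : Prop :=
  BddAbove (pVarSums p x a b)

/-- The `p`-variation norm `‖x‖_{p-var,[a,b]} = ‖x a‖ + |||x|||_{p-var,[a,b]}`. -/
def pVarNorm (p : ℝ) (x : ℝ → E) (a b : ℝ) : ℝ :=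
  ‖x a‖ + pVar p x a b

/-- A control function on `[a,b]`: continuous on the simplex, vanishing on the diagonal,
superadditive and nonnegative. -/
def IsControlOn (a b : ℝ) (w : ℝ → ℝ → ℝ) : Prop :=
  ContinuousOn (fun pr : ℝ × ℝ => w pr.1 pr.2) {pr : ℝ × ℝ | a ≤ pr.1 ∧ pr.1 ≤ pr.2 ∧ pr.2 ≤ b} ∧
  (∀ t : ℝ, a ≤ t → t ≤ b → w t t = 0) ∧
  (∀ s t u : ℝ, a ≤ s → s ≤ t → t ≤ u → u ≤ b → w s t + w t u ≤ w s u) ∧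
  (∀ s t : ℝ, a ≤ s → s ≤ t → t ≤ b → 0 ≤ w s t)

/-- A tagged partition `a = t 0 < t 1 < ⋯ < t n = b` of `[a,b]`, with tags
`tag i ∈ [t i, t (i+1)]`. -/
structure TaggedPartition (a b : ℝ) where
  n : ℕ
  t : Fin (n + 1) → ℝ
  tag : Fin n → ℝ
  mono : StrictMono t
  first : t 0 = a
  last : t (Fin.last n) = b
  tag_mem : ∀ i : Fin n, tag i ∈ Set.Icc (t i.castSucc) (t i.succ)

/-- The mesh of a tagged partition. -/
def TaggedPartition.mesh {a b : ℝ} (P : TaggedPartition a b) : ℝ :=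
  ⨆ i : Fin P.n, (P.t i.succ - P.t i.castSucc)

/-- Riemann–Stieltjes sum of `x` against `ω` along a tagged partition. -/
def RSSum (x : ℝ → E →L[ℝ] F) (ω : ℝ → E) {a b : ℝ} (P : TaggedPartition a b) : F :=
  ∑ i : Fin P.n, x (P.tag i) (ω (P.t i.succ) - ω (P.t i.castSucc))

/-- `v` is the Young integral `∫_a^b x dω`: the Riemann–Stieltjes sums converge to `v`
as the mesh tends to `0`. -/
def IsYoungIntegral (x : ℝ → E →L[ℝ] F) (ω : ℝ → E) (a b : ℝ) (v : F) : Prop :=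
  ∀ ε : ℝ, 0 < ε → ∃ δ : ℝ, 0 < δ ∧
    ∀ P : TaggedPartition a b, P.mesh < δ → ‖RSSum x ω P - v‖ < ε

/-- The Young integral `∫_a^b x dω` (an arbitrary value, `0`, if the limit does not exist). -/
def youngIntegral (x : ℝ → E →L[ℝ] F) (ω : ℝ → E) (a b : ℝ) : F :=
  letI := Classical.propDecidable (∃ v, IsYoungIntegral x ω a b v)
  if hv : ∃ v, IsYoungIntegral x ω a b v then hv.choose else 0

end PVarDefs

/-! ### The sewing lemma -/

section Sewing

theorem mul_rpow_superadditive {a₁ a₂ b₁ b₂ θ τ : ℝ} (ha₁ : 0 ≤ a₁) (ha₂ : 0 ≤ a₂)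
    (hb₁ : 0 ≤ b₁) (hb₂ : 0 ≤ b₂) (hθ : 0 < θ) (hτ : 0 < τ) (hsum : θ + τ = 1) :
    a₁ ^ θ * b₁ ^ τ + a₂ ^ θ * b₂ ^ τ ≤ (a₁ + a₂) ^ θ * (b₁ + b₂) ^ τ := by
  rcases eq_or_lt_of_le (add_nonneg ha₁ ha₂) with hA | hA
  · have h1 : a₁ = 0 := by linarith
    have h2 : a₂ = 0 := by linarith
    simp [h1, h2, Real.zero_rpow hθ.ne']
  rcases eq_or_lt_of_le (add_nonneg hb₁ hb₂) with hB | hB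
  · have h1 : b₁ = 0 := by linarith
    have h2 : b₂ = 0 := by linarith
    simp [h1, h2, Real.zero_rpow hτ.ne']
  have key : ∀ x y : ℝ, 0 ≤ x → 0 ≤ y → x ^ θ * y ^ τ ≤
      ((a₁ + a₂) ^ θ * (b₁ + b₂) ^ τ) * (θ * (x / (a₁ + a₂)) + τ * (y / (b₁ + b₂))) := by
    intro x y hx hy
    have h1 := Real.geom_mean_le_arith_mean2_weighted hθ.le hτ.le
      (div_nonneg hx hA.le) (div_nonneg hy hB.le) hsum
    have h2 : x ^ θ * y ^ τ = ((a₁ + a₂) ^ θ * (b₁ + b₂) ^ τ) *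
        ((x / (a₁ + a₂)) ^ θ * (y / (b₁ + b₂)) ^ τ) := by
      rw [Real.div_rpow hx hA.le, Real.div_rpow hy hB.le]
      have := (Real.rpow_pos_of_pos hA θ).ne'
      have := (Real.rpow_pos_of_pos hB τ).ne'
      field_simp
    rw [h2]
    gcongr
  have h3 : (θ * (a₁ / (a₁ + a₂)) + τ * (b₁ / (b₁ + b₂))) +
      (θ * (a₂ / (a₁ + a₂)) + τ * (b₂ / (b₁ + b₂))) = 1 := by
    field_simp
    linear_combination (a₁ + a₂) * (b₁ + b₂) * hsum
  calc _ ≤ _ := add_le_add (key _ _ ha₁ hb₁) (key _ _ ha₂ hb₂)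
    _ = _ := by rw [← mul_add, h3, mul_one]

/-- The constant of the sewing lemma with exponent `κ`. -/
def sewConst (κ : ℝ) : ℝ := 2 / (1 - 2 * (1 / 2) ^ κ)

theorem two_mul_half_rpow_lt_one {κ : ℝ} (hκ : 1 < κ) : 2 * (1 / 2 : ℝ) ^ κ < 1 := by
  have h : (1 / 2 : ℝ) ^ κ < (1 / 2 : ℝ) ^ (1 : ℝ) :=
    Real.rpow_lt_rpow_of_exponent_gt (by norm_num) (by norm_num) hκ
  rw [Real.rpow_one] at h
  linarith

theorem sewConst_nonneg {κ : ℝ} (hκ : 1 < κ) : 0 ≤ sewConst κ :=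
  div_nonneg zero_le_two (by linarith [two_mul_half_rpow_lt_one hκ])

theorem sewConst_eq {κ : ℝ} (hκ : 1 < κ) :
    2 * (1 / 2) ^ κ * sewConst κ + 2 = sewConst κ := by
  have : 1 - 2 * (1 / 2 : ℝ) ^ κ ≠ 0 := by linarith [two_mul_half_rpow_lt_one hκ]
  unfold sewConst
  field_simp
  ring

variable {F : Type*} [NormedAddCommGroup F]

/-- A nonnegative superadditive function of the subintervals of `[a,b]`. -/
structure SuperaddOn (a b : ℝ) (w : ℝ → ℝ → ℝ) : Prop where
  nonneg : ∀ s t, a ≤ s → s ≤ t → t ≤ b → 0 ≤ w s t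
  add_le : ∀ s u t, a ≤ s → s ≤ u → u ≤ t → t ≤ b → w s u + w u t ≤ w s t

namespace SuperaddOn

variable {a b : ℝ} {w : ℝ → ℝ → ℝ}

theorem self_eq_zero (hw : SuperaddOn a b w) {s : ℝ} (h1 : a ≤ s) (h2 : s ≤ b) : w s s = 0 := by
  linarith [hw.nonneg s s h1 le_rfl h2, hw.add_le s s s h1 le_rfl le_rfl h2]

theorem mono_set (hw : SuperaddOn a b w) {a' b' : ℝ} (ha : a ≤ a') (hb : b' ≤ b) :
    SuperaddOn a' b' w :=
  ⟨fun s t h1 h2 h3 => hw.nonneg s t (ha.trans h1) h2 (h3.trans hb),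
    fun s u t h1 h2 h3 h4 => hw.add_le s u t (ha.trans h1) h2 h3 (h4.trans hb)⟩

theorem mul_rpow {φ ψ : ℝ → ℝ} (hφ : MonotoneOn φ (Icc a b)) (hψ : MonotoneOn ψ (Icc a b))
    {θ τ : ℝ} (hθ : 0 < θ) (hτ : 0 < τ) (hsum : θ + τ = 1) :
    SuperaddOn a b (fun s t => (φ t - φ s) ^ θ * (ψ t - ψ s) ^ τ) where
  nonneg s t h1 h2 h3 := by
    have := hφ ⟨h1, h2.trans h3⟩ ⟨h1.trans h2, h3⟩ h2
    have := hψ ⟨h1, h2.trans h3⟩ ⟨h1.trans h2, h3⟩ h2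
    exact mul_nonneg (Real.rpow_nonneg (by linarith) _) (Real.rpow_nonneg (by linarith) _)
  add_le s u t h1 h2 h3 h4 := by
    have hs : s ∈ Icc a b := ⟨h1, h2.trans (h3.trans h4)⟩
    have hu : u ∈ Icc a b := ⟨h1.trans h2, h3.trans h4⟩
    have ht : t ∈ Icc a b := ⟨h1.trans (h2.trans h3), h4⟩
    have := mul_rpow_superadditive (sub_nonneg.2 (hφ hs hu h2)) (sub_nonneg.2 (hφ hu ht h3))
      (sub_nonneg.2 (hψ hs hu h2)) (sub_nonneg.2 (hψ hu ht h3)) hθ hτ hsum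
    simpa using this

end SuperaddOn

/-- Young's maximal inequality for partitions. -/
theorem norm_sum_sub_le_of_superaddOn {a b K κ : ℝ} {w : ℝ → ℝ → ℝ} {Ξ : ℝ → ℝ → F}
    (hκ : 1 < κ) (hK : 0 ≤ K) (hw : SuperaddOn a b w) (hΞ : ∀ s, Ξ s s = 0)
    (hδ : ∀ s u t, a ≤ s → s ≤ u → u ≤ t → t ≤ b →
      ‖Ξ s t - Ξ s u - Ξ u t‖ ≤ K * w s t ^ κ)
    {t : ℕ → ℝ} (ht : Monotone t) (n : ℕ) : ∀ i, a ≤ t i → t (i + n) ≤ b →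
      ‖∑ k ∈ Finset.range n, Ξ (t (i + k)) (t (i + k + 1)) - Ξ (t i) (t (i + n))‖ ≤
        sewConst κ * K * w (t i) (t (i + n)) ^ κ := by
  induction n using Nat.strong_induction_on with
  | _ n ih =>
  intro i hai hb
  rcases Nat.eq_zero_or_pos n with rfl | hn
  · simp only [Finset.range_zero, Finset.sum_empty, add_zero, hΞ, sub_zero, norm_zero]
    exact mul_nonneg (mul_nonneg (sewConst_nonneg hκ) hK)
      (Real.rpow_nonneg (hw.nonneg _ _ hai le_rfl hb) _)
  set W := w (t i) (t (i + n)) with hW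
  have hW0 : 0 ≤ W := hw.nonneg _ _ hai (ht (by omega)) hb
  obtain ⟨j, hj, hj1, hj2⟩ : ∃ j < n, w (t i) (t (i + j)) ≤ W / 2 ∧
      w (t (i + j + 1)) (t (i + n)) ≤ W / 2 := by
    have h0 : w (t i) (t (i + 0)) ≤ W / 2 := by
      rw [add_zero, hw.self_eq_zero hai ((ht (by omega)).trans hb)]
      positivity
    let P : ℕ → Prop := fun j => w (t i) (t (i + j)) ≤ W / 2
    classical
    have hP : P (Nat.findGreatest P (n - 1)) :=
      Nat.findGreatest_spec (P := P) (Nat.zero_le _) h0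
    have hle := Nat.findGreatest_le (P := P) (n - 1)
    set j := Nat.findGreatest P (n - 1) with hj
    refine ⟨j, by omega, hP, ?_⟩
    rcases Nat.lt_or_ge j (n - 1) with hlt | hge
    · have hnot : ¬ P (j + 1) :=
        Nat.findGreatest_is_greatest (P := P) (Nat.lt_succ_self _) (by omega)
      have h1 : W / 2 < w (t i) (t (i + j + 1)) := by simpa [P, ← add_assoc] using hnot
      have h2 := hw.add_le (t i) (t (i + j + 1)) (t (i + n)) hai (ht (by omega))
        (ht (by omega)) hb
      linarith
    · have h1 : i + j + 1 = i + n := by omega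
      rw [h1, hw.self_eq_zero (hai.trans (ht (by omega))) hb]
      positivity
  have e1 := ih j hj i hai ((ht (by omega)).trans hb)
  have hn2 : i + j + 1 + (n - j - 1) = i + n := by omega
  have e2 := ih (n - j - 1) (by omega) (i + j + 1) (hai.trans (ht (by omega)))
    (by rw [hn2]; exact hb)
  rw [hn2] at e2
  have e3 := hδ (t i) (t (i + j)) (t (i + n)) hai (ht (by omega)) (ht (by omega)) hb
  have e4 := hδ (t (i + j)) (t (i + j + 1)) (t (i + n)) (hai.trans (ht (by omega)))
    (ht (by omega)) (ht (by omega)) hb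
  have hsum : ∑ k ∈ Finset.range n, Ξ (t (i + k)) (t (i + k + 1)) =
      ∑ k ∈ Finset.range j, Ξ (t (i + k)) (t (i + k + 1)) + Ξ (t (i + j)) (t (i + j + 1)) +
      ∑ k ∈ Finset.range (n - j - 1), Ξ (t (i + j + 1 + k)) (t (i + j + 1 + k + 1)) := by
    have hn3 : n = (j + 1) + (n - j - 1) := by omega
    conv_lhs => rw [hn3, Finset.sum_range_add, Finset.sum_range_succ]
    simp only [add_assoc]
  have hhalf : ∀ x, 0 ≤ x → x ≤ W / 2 → x ^ κ ≤ (1 / 2) ^ κ * W ^ κ := by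
    intro x hx hxW
    rw [← Real.mul_rpow (by norm_num) hW0]
    exact Real.rpow_le_rpow hx (by linarith) (by linarith)
  have f1 := hhalf _ (hw.nonneg _ _ hai (ht (by omega)) ((ht (by omega)).trans hb)) hj1
  have f2 := hhalf _ (hw.nonneg _ _ (hai.trans (ht (by omega))) (ht (by omega)) hb) hj2
  have f3 : w (t (i + j)) (t (i + n)) ^ κ ≤ W ^ κ := by
    refine Real.rpow_le_rpow (hw.nonneg _ _ (hai.trans (ht (by omega))) (ht (by omega)) hb) ?_
      (by linarith)
    linarith [hw.add_le (t i) (t (i + j)) (t (i + n)) hai (ht (by omega)) (ht (by omega)) hb,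
      hw.nonneg (t i) (t (i + j)) hai (ht (by omega)) ((ht (by omega)).trans hb)]
  have hC := sewConst_nonneg hκ
  have hCK : 0 ≤ sewConst κ * K := mul_nonneg hC hK
  calc _ = ‖((∑ k ∈ Finset.range j, Ξ (t (i + k)) (t (i + k + 1)) - Ξ (t i) (t (i + j))) +
        (∑ k ∈ Finset.range (n - j - 1), Ξ (t (i + j + 1 + k)) (t (i + j + 1 + k + 1)) -
          Ξ (t (i + j + 1)) (t (i + n)))) -
        ((Ξ (t i) (t (i + n)) - Ξ (t i) (t (i + j)) - Ξ (t (i + j)) (t (i + n))) +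
        (Ξ (t (i + j)) (t (i + n)) - Ξ (t (i + j)) (t (i + j + 1)) -
          Ξ (t (i + j + 1)) (t (i + n))))‖ := by
        rw [hsum]; congr 1; abel
    _ ≤ (sewConst κ * K * w (t i) (t (i + j)) ^ κ +
        sewConst κ * K * w (t (i + j + 1)) (t (i + n)) ^ κ) +
        (K * W ^ κ + K * w (t (i + j)) (t (i + n)) ^ κ) :=
        (norm_sub_le _ _).trans (add_le_add ((norm_add_le _ _).trans (add_le_add e1 e2))
          ((norm_add_le _ _).trans (add_le_add e3 e4)))
    _ ≤ (sewConst κ * K * ((1 / 2) ^ κ * W ^ κ) + sewConst κ * K * ((1 / 2) ^ κ * W ^ κ)) +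
        (K * W ^ κ + K * W ^ κ) := by gcongr
    _ = (2 * (1 / 2) ^ κ * sewConst κ + 2) * K * W ^ κ := by ring
    _ = _ := by rw [sewConst_eq hκ]

/-- Every finite set of reals is enumerated by a monotone sequence. -/
theorem exists_monotone_enum (s : Finset ℝ) (hs : s.Nonempty) :
    ∃ t : ℕ → ℝ, Monotone t ∧ (∀ k, t k ∈ s) ∧
      ∃ idx : ℝ → ℕ, (∀ x ∈ s, t (idx x) = x) ∧
        ∀ x ∈ s, ∀ y ∈ s, x ≤ y → idx x ≤ idx y := by
  have hc : 0 < s.card := hs.card_pos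
  let e := s.orderEmbOfFin rfl
  have hidx : ∀ x : ℝ, ∃ i : Fin s.card, x ∈ s → e i = x := by
    intro x
    by_cases hx : x ∈ s
    · have : x ∈ Set.range e := by rw [Finset.range_orderEmbOfFin]; exact hx
      obtain ⟨i, hi⟩ := this
      exact ⟨i, fun _ => hi⟩
    · exact ⟨⟨0, hc⟩, fun h => absurd h hx⟩
  choose idx hidx using hidx
  have hm : ∀ k : ℕ, min k (s.card - 1) < s.card := fun k => by omega
  refine ⟨fun k => e ⟨min k (s.card - 1), hm k⟩, ?_, fun k => Finset.orderEmbOfFin_mem _ _ _,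
    fun x => idx x, ?_, ?_⟩
  · intro i j hij
    apply e.monotone
    simp only [Fin.mk_le_mk]
    omega
  · intro x hx
    have h1 : (⟨min (idx x) (s.card - 1), hm _⟩ : Fin s.card) = idx x :=
      Fin.ext (by have := (idx x).2; simp only; omega)
    simp only [h1]
    exact hidx x hx
  · intro x hx y hy hxy
    rw [← hidx x hx, ← hidx y hy] at hxy
    exact e.le_iff_le.1 hxy

/-- The sewing lemma. The bound is local: on each subinterval it holds with any constant
that controls the defect of additivity of `Ξ` there. -/
theorem exists_sewing [ProperSpace F] {a b K κ : ℝ} {w : ℝ → ℝ → ℝ} {Ξ : ℝ → ℝ → F}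
    (hκ : 1 < κ) (hK : 0 ≤ K) (hw : SuperaddOn a b w) (hΞ : ∀ s, Ξ s s = 0)
    (hδ : ∀ s u t, a ≤ s → s ≤ u → u ≤ t → t ≤ b →
      ‖Ξ s t - Ξ s u - Ξ u t‖ ≤ K * w s t ^ κ) :
    ∃ J : ℝ → F, ∀ u v, a ≤ u → u ≤ v → v ≤ b → ∀ K', 0 ≤ K' →
      (∀ r s t, u ≤ r → r ≤ s → s ≤ t → t ≤ v → ‖Ξ r t - Ξ r s - Ξ s t‖ ≤ K' * w r t ^ κ) →
      ‖J v - J u - Ξ u v‖ ≤ sewConst κ * K' * w u v ^ κ := by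
  classical
  have hfin : ∀ s : Finset ℝ, ∃ J : ℝ → F, J a = 0 ∧ ∀ u ∈ s, ∀ v ∈ s, a ≤ u → u ≤ v → v ≤ b →
      ∀ K', 0 ≤ K' →
      (∀ r s t, u ≤ r → r ≤ s → s ≤ t → t ≤ v → ‖Ξ r t - Ξ r s - Ξ s t‖ ≤ K' * w r t ^ κ) →
      ‖J v - J u - Ξ u v‖ ≤ sewConst κ * K' * w u v ^ κ := by
    intro s
    rcases s.eq_empty_or_nonempty with rfl | hs
    · exact ⟨0, rfl, fun u hu => by simp at hu⟩
    obtain ⟨t, ht, -, idx, hidx, hmono⟩ := exists_monotone_enum s hs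
    let J : ℝ → F := fun x => ∑ k ∈ Finset.range (idx x), Ξ (t k) (t (k + 1))
    refine ⟨fun x => J x - J a, by simp, ?_⟩
    intro u hu v hv hau huv hvb K' hK' hloc
    have hij := hmono u hu v hv huv
    obtain ⟨n, hn⟩ := Nat.exists_eq_add_of_le hij
    have h1 := norm_sum_sub_le_of_superaddOn hκ hK' (hw.mono_set hau hvb) hΞ hloc ht n (idx u)
      (hidx u hu).ge (by rw [← hn, hidx v hv])
    rw [← hn, hidx u hu, hidx v hv] at h1
    have h2 : J v - J a - (J u - J a) =
        ∑ k ∈ Finset.range n, Ξ (t (idx u + k)) (t (idx u + k + 1)) := by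
      simp only [J, hn, Finset.sum_range_add]
      abel
    rw [h2]
    exact h1
  choose J hJ0 hJ using hfin
  let l : Ultrafilter (Finset ℝ) := Ultrafilter.of Filter.atTop
  have hl : ∀ x : ℝ, ∀ᶠ s in (l : Filter (Finset ℝ)), x ∈ s := by
    intro x
    refine Ultrafilter.of_le Filter.atTop ?_
    filter_upwards [Filter.eventually_ge_atTop ({x} : Finset ℝ)] with s hs
    exact hs (Finset.mem_singleton_self x)
  have hlim : ∀ x : ℝ, ∃ y, x ∈ Icc a b →
      Filter.Tendsto (fun s => J s x) (l : Filter (Finset ℝ)) (nhds y) := by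
    intro x
    by_cases hx : x ∈ Icc a b
    · have hev : ∀ᶠ s in (l : Filter (Finset ℝ)), J s x ∈
          Metric.closedBall (0 : F) (‖Ξ a x‖ + sewConst κ * K * w a x ^ κ) := by
        filter_upwards [hl a, hl x] with s ha hxs
        have h1 := hJ s a ha x hxs le_rfl hx.1 hx.2 K hK
          (fun r s t h1 h2 h3 h4 => hδ r s t h1 h2 h3 (h4.trans hx.2))
        rw [hJ0, sub_zero] at h1
        rw [mem_closedBall_zero_iff]
        have h2 := norm_add_le (Ξ a x) (J s x - Ξ a x)
        rw [add_sub_cancel] at h2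
        linarith
      obtain ⟨y, -, hy⟩ := (isCompact_closedBall (0 : F) _).ultrafilter_le_nhds
        (l.map (fun s => J s x)) (by
          rw [Filter.le_principal_iff]
          exact hev)
      exact ⟨y, fun _ => hy⟩
    · exact ⟨0, fun h => absurd h hx⟩
  choose J' hJ' using hlim
  refine ⟨J', ?_⟩
  intro u v hau huv hvb K' hK' hloc
  have hu := hJ' u ⟨hau, huv.trans hvb⟩
  have hv := hJ' v ⟨hau.trans huv, hvb⟩
  refine le_of_tendsto ((hv.sub hu).sub_const (Ξ u v)).norm ?_
  filter_upwards [hl u, hl v] with s hus hvs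
  exact hJ s u hus v hvs hau huv hvb K' hK' hloc

end Sewing

/-! ### Young integrals -/

section YoungIntegral

variable {E F : Type*} [NormedAddCommGroup E] [NormedSpace ℝ E]
  [NormedAddCommGroup F] [NormedSpace ℝ F]

theorem sum_fin_succ_sub_castSucc {A : Type*} [AddCommGroup A] :
    ∀ (n : ℕ) (f : Fin (n + 1) → A),
      ∑ i : Fin n, (f i.succ - f i.castSucc) = f (Fin.last n) - f 0 := by
  intro n
  induction n with
  | zero => intro f; simp
  | succ n ih =>
    intro f
    rw [Fin.sum_univ_castSucc]
    have := ih (fun i => f i.castSucc)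
    simp only [← Fin.succ_castSucc] at this ⊢
    rw [this]
    simp

theorem isYoungIntegral_of_local {G : ℝ → E →L[ℝ] F} {ω : ℝ → E} {J : ℝ → F} {ψ : ℝ → ℝ}
    {a b : ℝ} (hab : a ≤ b) (hψ : MonotoneOn ψ (Icc a b))
    (hloc : ∀ ε : ℝ, 0 < ε → ∃ η : ℝ, 0 < η ∧ ∀ u ξ v, a ≤ u → u ≤ ξ → ξ ≤ v → v ≤ b →
      v - u ≤ η → ‖J v - J u - G ξ (ω v - ω u)‖ ≤ ε * (ψ v - ψ u)) :
    IsYoungIntegral G ω a b (J b - J a) := by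
  intro ε hε
  have hΔ : 0 ≤ ψ b - ψ a := sub_nonneg.2 (hψ ⟨le_rfl, hab⟩ ⟨hab, le_rfl⟩ hab)
  obtain ⟨η, hη, h⟩ := hloc (ε / (ψ b - ψ a + 1)) (by positivity)
  refine ⟨η, hη, fun P hP => ?_⟩
  have h1 : RSSum G ω P - (J b - J a) = -∑ i : Fin P.n, (J (P.t i.succ) - J (P.t i.castSucc) -
      G (P.tag i) (ω (P.t i.succ) - ω (P.t i.castSucc))) := by
    rw [Finset.sum_sub_distrib, sum_fin_succ_sub_castSucc P.n (fun i => J (P.t i)), P.first,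
      P.last, RSSum]
    abel
  rw [h1, norm_neg]
  have h2 : ∑ i : Fin P.n, (ψ (P.t i.succ) - ψ (P.t i.castSucc)) = ψ b - ψ a := by
    rw [sum_fin_succ_sub_castSucc P.n (fun i => ψ (P.t i)), P.first, P.last]
  have h3 : ∀ i : Fin P.n, ‖J (P.t i.succ) - J (P.t i.castSucc) -
      G (P.tag i) (ω (P.t i.succ) - ω (P.t i.castSucc))‖ ≤
      ε / (ψ b - ψ a + 1) * (ψ (P.t i.succ) - ψ (P.t i.castSucc)) := by
    intro i
    refine h _ _ _ ?_ (P.tag_mem i).1 (P.tag_mem i).2 ?_ ?_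
    · exact P.first.ge.trans (P.mono.monotone (Fin.zero_le _))
    · exact (P.mono.monotone (Fin.le_last _)).trans P.last.le
    · refine le_trans ?_ hP.le
      exact le_ciSup (f := fun i : Fin P.n => P.t i.succ - P.t i.castSucc)
        (Set.finite_range _).bddAbove i
  calc _ ≤ ∑ i : Fin P.n, ε / (ψ b - ψ a + 1) * (ψ (P.t i.succ) - ψ (P.t i.castSucc)) :=
        norm_sum_le_of_le _ fun i _ => h3 i
    _ = ε / (ψ b - ψ a + 1) * (ψ b - ψ a) := by rw [← Finset.mul_sum, h2]
    _ < ε := by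
        rw [div_mul_eq_mul_div, div_lt_iff₀ (by positivity)]
        nlinarith

theorem exists_taggedPartition_mesh_lt {a b η : ℝ} (hab : a ≤ b) (hη : 0 < η) :
    ∃ P : TaggedPartition a b, P.mesh < η := by
  rcases eq_or_lt_of_le hab with rfl | hlt
  · refine ⟨⟨0, fun _ => a, Fin.elim0, fun i j h => by omega, rfl, rfl, fun i => i.elim0⟩, ?_⟩
    simpa [TaggedPartition.mesh] using hη
  obtain ⟨n, hn⟩ := exists_nat_gt ((b - a) / η)
  have hn0 : (0 : ℝ) < n := lt_trans (div_pos (by linarith) hη) hn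
  have hc : 0 < (b - a) / n := div_pos (by linarith) hn0
  have hmono : StrictMono (fun i : Fin (n + 1) => a + (b - a) / n * (i : ℕ)) := by
    intro i j hij
    have : ((i : ℕ) : ℝ) < (j : ℕ) := by exact_mod_cast hij
    simp only
    gcongr
  refine ⟨⟨n, fun i => a + (b - a) / n * (i : ℕ), fun i => a + (b - a) / n * (i : ℕ), hmono,
    by simp, ?_, fun i => ⟨by simp, ?_⟩⟩, ?_⟩
  · simp only [Fin.val_last]
    field_simp
    ring
  · exact hmono.monotone (Fin.castSucc_le_succ i)
  · have hne : Nonempty (Fin n) := ⟨⟨0, by exact_mod_cast hn0⟩⟩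
    have h1 : (b - a) / n < η := by
      rw [div_lt_iff₀ hn0]
      rw [div_lt_iff₀ hη] at hn
      linarith
    refine lt_of_le_of_lt (ciSup_le fun i => ?_) h1
    simp only [Fin.val_succ, Fin.val_castSucc, Nat.cast_add, Nat.cast_one]
    linarith

theorem IsYoungIntegral.youngIntegral_eq {G : ℝ → E →L[ℝ] F} {ω : ℝ → E} {a b : ℝ} {v : F}
    (hv : IsYoungIntegral G ω a b v) (hab : a ≤ b) : youngIntegral G ω a b = v := by
  have hex : ∃ v, IsYoungIntegral G ω a b v := ⟨v, hv⟩
  have h0 : youngIntegral G ω a b = hex.choose := dif_pos hex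
  rw [h0]
  have hu := hex.choose_spec
  refine eq_of_forall_dist_le fun ε hε => ?_
  obtain ⟨η₁, hη₁, h1⟩ := hu (ε / 2) (by positivity)
  obtain ⟨η₂, hη₂, h2⟩ := hv (ε / 2) (by positivity)
  obtain ⟨P, hP⟩ := exists_taggedPartition_mesh_lt hab (lt_min hη₁ hη₂)
  have e1 := h1 P (hP.trans_le (min_le_left _ _))
  have e2 := h2 P (hP.trans_le (min_le_right _ _))
  rw [← dist_eq_norm] at e1 e2
  linarith [dist_triangle_left hex.choose v (RSSum G ω P)]

/-- `J` is an indefinite Young integral of `G` against `ω` on `[a,b]`: the error made by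
replacing its increments by `G u (ω v - ω u)` is negligible compared to an additive control. -/
def IsYoungPrimitive (G : ℝ → E →L[ℝ] F) (ω : ℝ → E) (J : ℝ → F) (a b : ℝ) : Prop :=
  ∃ ψ : ℝ → ℝ, MonotoneOn ψ (Icc a b) ∧ ∀ ε : ℝ, 0 < ε → ∃ η : ℝ, 0 < η ∧
    ∀ u v, a ≤ u → u ≤ v → v ≤ b → v - u ≤ η →
      ‖J v - J u - G u (ω v - ω u)‖ ≤ ε * (ψ v - ψ u)

namespace IsYoungPrimitive

variable {G G' : ℝ → E →L[ℝ] F} {ω : ℝ → E} {J J' : ℝ → F} {a b : ℝ}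

theorem mono_set (h : IsYoungPrimitive G ω J a b) {a' b' : ℝ} (ha : a ≤ a') (hb : b' ≤ b) :
    IsYoungPrimitive G ω J a' b' := by
  obtain ⟨ψ, hψ, hs⟩ := h
  refine ⟨ψ, hψ.mono (Icc_subset_Icc ha hb), fun ε hε => ?_⟩
  obtain ⟨η, hη, h⟩ := hs ε hε
  exact ⟨η, hη, fun u v h1 h2 h3 => h u v (ha.trans h1) h2 (h3.trans hb)⟩

theorem sub (h : IsYoungPrimitive G ω J a b) (h' : IsYoungPrimitive G' ω J' a b) :
    IsYoungPrimitive (fun r => G r - G' r) ω (fun r => J r - J' r) a b := by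
  obtain ⟨ψ, hψ, hs⟩ := h
  obtain ⟨ψ', hψ', hs'⟩ := h'
  refine ⟨fun r => ψ r + ψ' r, hψ.add hψ', fun ε hε => ?_⟩
  obtain ⟨η, hη, h⟩ := hs ε hε
  obtain ⟨η', hη', h'⟩ := hs' ε hε
  refine ⟨min η η', lt_min hη hη', fun u v h1 h2 h3 h4 => ?_⟩
  have e := h u v h1 h2 h3 (h4.trans (min_le_left _ _))
  have e' := h' u v h1 h2 h3 (h4.trans (min_le_right _ _))
  have : J v - J' v - (J u - J' u) - (G u - G' u) (ω v - ω u) =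
      (J v - J u - G u (ω v - ω u)) - (J' v - J' u - G' u (ω v - ω u)) := by
    rw [sub_apply]; abel
  rw [this]
  linarith [norm_sub_le (J v - J u - G u (ω v - ω u)) (J' v - J' u - G' u (ω v - ω u))]

theorem norm_defect_le {s u t : ℝ} :
    ‖G s (ω t - ω s) - G s (ω u - ω s) - G u (ω t - ω u)‖ ≤ ‖G u - G s‖ * ‖ω t - ω u‖ := by
  have : G s (ω t - ω s) - G s (ω u - ω s) - G u (ω t - ω u) =
      -((G u - G s) (ω t - ω u)) := by
    simp only [map_sub, sub_apply]; abel
  rw [this, norm_neg]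
  exact ContinuousLinearMap.le_opNorm _ _

/-- The Young–Loève estimate. -/
theorem norm_error_le (h : IsYoungPrimitive G ω J a b) {w : ℝ → ℝ → ℝ} {K κ : ℝ}
    (hκ : 1 < κ) (hK : 0 ≤ K) (hw : SuperaddOn a b w)
    (hG : ∀ s u t, a ≤ s → s ≤ u → u ≤ t → t ≤ b →
      ‖G u - G s‖ * ‖ω t - ω u‖ ≤ K * w s t ^ κ)
    {u v : ℝ} (hau : a ≤ u) (huv : u ≤ v) (hvb : v ≤ b) :
    ‖J v - J u - G u (ω v - ω u)‖ ≤ sewConst κ * K * w u v ^ κ := by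
  obtain ⟨ψ, hψ, hs⟩ := h.mono_set hau hvb
  have hΔ : 0 ≤ ψ v - ψ u := sub_nonneg.2 (hψ ⟨le_rfl, huv⟩ ⟨huv, le_rfl⟩ huv)
  refine le_of_forall_pos_le_add fun ε hε => ?_
  obtain ⟨η, hη, h⟩ := hs (ε / (ψ v - ψ u + 1)) (by positivity)
  obtain ⟨n, hn⟩ := exists_nat_gt ((v - u) / η)
  have hn0 : (0 : ℝ) < n := lt_of_le_of_lt (div_nonneg (by linarith) hη.le) hn
  have hc : 0 ≤ (v - u) / n := div_nonneg (by linarith) hn0.le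
  let t : ℕ → ℝ := fun k => u + (v - u) / n * k
  have ht : Monotone t := fun i j hij => by
    have : (i : ℝ) ≤ j := by exact_mod_cast hij
    simp only [t]
    gcongr
  have ht0 : t 0 = u := by simp [t]
  have htn : t n = v := by simp only [t]; field_simp; ring
  have h1 := norm_sum_sub_le_of_superaddOn (Ξ := fun s t => G s (ω t - ω s)) hκ hK hw (by simp)
    (fun s u t h1 h2 h3 h4 => norm_defect_le.trans (hG s u t h1 h2 h3 h4)) ht n 0
    (by rw [ht0]; exact hau) (by rw [zero_add, htn]; exact hvb)
  simp only [zero_add, ht0, htn] at h1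
  have h2 : ∀ k ∈ Finset.range n,
      ‖J (t (k + 1)) - J (t k) - G (t k) (ω (t (k + 1)) - ω (t k))‖ ≤
      ε / (ψ v - ψ u + 1) * (ψ (t (k + 1)) - ψ (t k)) := by
    intro k hk
    have hk' := Finset.mem_range.1 hk
    refine h _ _ (ht0 ▸ ht (Nat.zero_le _)) (ht (Nat.le_succ _)) (htn ▸ ht hk') ?_
    have : t (k + 1) - t k = (v - u) / n := by simp only [t]; push_cast; ring
    rw [this, div_le_iff₀ hn0]
    rw [div_lt_iff₀ hη] at hn
    linarith
  have h3 := norm_sum_le_of_le _ h2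
  rw [← Finset.mul_sum, Finset.sum_range_sub (fun k => ψ (t k)), Finset.sum_sub_distrib,
    Finset.sum_range_sub (fun k => J (t k)), ht0, htn] at h3
  have h4 : ε / (ψ v - ψ u + 1) * (ψ v - ψ u) ≤ ε := by
    rw [div_mul_eq_mul_div, div_le_iff₀ (by positivity)]
    nlinarith
  have h5 := norm_add_le
    (J v - J u - ∑ k ∈ Finset.range n, G (t k) (ω (t (k + 1)) - ω (t k)))
    (∑ k ∈ Finset.range n, G (t k) (ω (t (k + 1)) - ω (t k)) - G u (ω v - ω u))
  rw [sub_add_sub_cancel] at h5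
  linarith

end IsYoungPrimitive

end YoungIntegral

/-! ### Paths of finite variation -/

section Variation

variable {E : Type*} [NormedAddCommGroup E]

theorem pVarSums_snoc {p a u v c : ℝ} {x : ℝ → E} (huv : u < v) (hc : c ∈ pVarSums p x a u) :
    c + ‖x v - x u‖ ^ p ∈ pVarSums p x a v := by
  obtain ⟨n, t, ht, h0, hl, rfl⟩ := hc
  refine ⟨n + 1, Fin.snoc t v, ?_, ?_, ?_, ?_⟩
  · rw [Fin.strictMono_iff_lt_succ]
    intro i
    refine Fin.lastCases ?_ (fun j => ?_) i
    · rw [Fin.succ_last, Fin.snoc_last, Fin.snoc_castSucc, hl]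
      exact huv
    · rw [Fin.succ_castSucc, Fin.snoc_castSucc, Fin.snoc_castSucc]
      exact ht Fin.castSucc_lt_succ
  · rw [← Fin.castSucc_zero, Fin.snoc_castSucc, h0]
  · rw [Fin.snoc_last]
  · rw [Fin.sum_univ_castSucc]
    simp only [Fin.succ_castSucc, Fin.snoc_castSucc, Fin.succ_last, Fin.snoc_last, hl]

theorem zero_mem_pVarSums_self (p a : ℝ) (x : ℝ → E) : (0 : ℝ) ∈ pVarSums p x a a :=
  ⟨0, fun _ => a, fun i j h => by omega, rfl, rfl, by simp⟩

/-- A path of finite `p`-variation is controlled by a monotone function. -/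
theorem FinitePVar.exists_monotoneOn {p a b : ℝ} {x : ℝ → E} (hp : 0 < p)
    (hx : FinitePVar p x a b) :
    ∃ V : ℝ → ℝ, MonotoneOn V (Icc a b) ∧
      ∀ u v, a ≤ u → u ≤ v → v ≤ b → ‖x v - x u‖ ^ p ≤ V v - V u := by
  have hbdd : ∀ u, u ≤ b → BddAbove (pVarSums p x a u) := by
    intro u hu
    rcases eq_or_lt_of_le hu with rfl | hlt
    · exact hx
    · obtain ⟨B, hB⟩ := hx
      refine ⟨B, fun c hc => ?_⟩
      have := hB (pVarSums_snoc hlt hc)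
      linarith [Real.rpow_nonneg (norm_nonneg (x b - x u)) p]
  have hne : ∀ u, a ≤ u → (pVarSums p x a u).Nonempty := by
    intro u hu
    rcases eq_or_lt_of_le hu with rfl | hlt
    · exact ⟨0, zero_mem_pVarSums_self p a x⟩
    · exact ⟨_, pVarSums_snoc hlt (zero_mem_pVarSums_self p a x)⟩
  have key : ∀ u v, a ≤ u → u ≤ v → v ≤ b →
      ‖x v - x u‖ ^ p ≤ sSup (pVarSums p x a v) - sSup (pVarSums p x a u) := by
    intro u v hau huv hvb
    rcases eq_or_lt_of_le huv with rfl | hlt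
    · simp [Real.zero_rpow hp.ne']
    · have : sSup (pVarSums p x a u) ≤ sSup (pVarSums p x a v) - ‖x v - x u‖ ^ p := by
        refine csSup_le (hne u hau) fun c hc => ?_
        linarith [le_csSup (hbdd v hvb) (pVarSums_snoc hlt hc)]
      linarith
  refine ⟨fun u => sSup (pVarSums p x a u), fun u hu v hv huv => ?_, key⟩
  linarith [key u v hu.1 huv hv.2, Real.rpow_nonneg (norm_nonneg (x v - x u)) p]

end Variation

/-! ### Young differential equations -/

section YoungEquation

/-- The data of a Young differential equation on `[0,T]`, where the driving path, the time
dependence of the coefficient `g` and time itself are measured by one monotone function `φ`. -/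
structure YoungSystem (d m : ℕ) where
  f : ℝ → Ed d → Ed d
  g : ℝ → Ed d → (Ed m →L[ℝ] Ed d)
  Dg : ℝ → Ed d → (Ed d →L[ℝ] Ed m →L[ℝ] Ed d)
  ω : ℝ → Ed m
  φ : ℝ → ℝ
  T : ℝ
  lam : ℝ
  mu : ℝ
  δ : ℝ
  Lg : ℝ
  cω : ℝ
  cH : ℝ
  continuous_f : Continuous (fun pr : ℝ × Ed d => f pr.1 pr.2)
  continuous_g : Continuous (fun pr : ℝ × Ed d => g pr.1 pr.2)
  hasFDerivAt_g : ∀ t x, HasFDerivAt (g t) (Dg t x) x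
  Lg_nonneg : 0 ≤ Lg
  cω_nonneg : 0 ≤ cω
  cH_nonneg : 0 ≤ cH
  norm_g_sub_le : ∀ t x y, ‖g t x - g t y‖ ≤ Lg * ‖x - y‖
  holder_Dg : ∀ R : ℝ, 0 ≤ R → ∃ M : ℝ, 0 ≤ M ∧ ∀ t x y, ‖x‖ ≤ R → ‖y‖ ≤ R →
    ‖Dg t x - Dg t y‖ ≤ M * ‖x - y‖ ^ δ
  lipschitz_f : ∀ R : ℝ, 0 ≤ R → ∃ L : ℝ, 0 ≤ L ∧ ∀ t x y, ‖x‖ ≤ R → ‖y‖ ≤ R →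
    ‖f t x - f t y‖ ≤ L * ‖x - y‖
  lam_pos : 0 < lam
  mu_pos : 0 < mu
  mu_le_lam : mu ≤ lam
  mu_le_lam_mul : mu ≤ lam * δ
  one_lt : 1 < lam + mu
  δ_pos : 0 < δ
  monotoneOn_φ : MonotoneOn φ (Icc 0 T)
  φ_total : φ T - φ 0 ≤ 1
  time_g : ∀ s t, 0 ≤ s → s ≤ t → t ≤ T → ∀ x, ‖g t x - g s x‖ ≤ cH * (φ t - φ s) ^ mu
  time_Dg : ∀ s t, 0 ≤ s → s ≤ t → t ≤ T → ∀ x, ‖Dg t x - Dg s x‖ ≤ cH * (φ t - φ s) ^ mu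
  norm_ω_sub_le : ∀ s t, 0 ≤ s → s ≤ t → t ≤ T → ‖ω t - ω s‖ ≤ cω * (φ t - φ s) ^ lam
  time_le : ∀ s t, 0 ≤ s → s ≤ t → t ≤ T → t - s ≤ cω * (φ t - φ s) ^ lam
  small : ∀ ρ : ℝ, 0 < ρ → ∃ η : ℝ, 0 < η ∧ ∀ s t, 0 ≤ s → s ≤ t → t ≤ T → t - s ≤ η →
    ‖ω t - ω s‖ ≤ ρ * (φ t - φ s) ^ lam ∧ t - s ≤ ρ * (φ t - φ s) ^ lam

theorem le_of_bootstrap {ι : Type*} {a c : ι → ℝ} {A N₀ : ℝ} (hA : 0 ≤ A) (hN₀ : 0 ≤ N₀)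
    (hc : ∀ i, 0 ≤ c i) (h₀ : ∀ i, a i ≤ N₀ * c i)
    (step : ∀ N, 0 ≤ N → (∀ i, a i ≤ N * c i) → ∀ i, a i ≤ (A + N / 2) * c i) (i : ι) :
    a i ≤ 2 * A * c i := by
  have h : ∀ n : ℕ, ∀ i, a i ≤ (2 * A + N₀ * (1 / 2) ^ n) * c i := by
    intro n
    induction n with
    | zero =>
      intro i
      refine (h₀ i).trans (mul_le_mul_of_nonneg_right ?_ (hc i))
      simpa using hA
    | succ n ih =>
      intro i
      refine (step _ (by positivity) ih i).trans_eq ?_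
      ring
  have hlim : Filter.Tendsto (fun n : ℕ => (2 * A + N₀ * (1 / 2) ^ n) * c i) Filter.atTop
      (nhds ((2 * A + N₀ * 0) * c i)) :=
    ((((tendsto_pow_atTop_nhds_zero_of_lt_one (by norm_num) (by norm_num)).const_mul
      N₀).const_add (2 * A)).mul_const (c i))
  have := ge_of_tendsto' hlim fun n => h n i
  simpa using this

namespace YoungSystem

variable {d m : ℕ} (S : YoungSystem d m)

theorem sub_nonneg {u v : ℝ} (h1 : 0 ≤ u) (h2 : u ≤ v) (h3 : v ≤ S.T) : 0 ≤ S.φ v - S.φ u :=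
  _root_.sub_nonneg.2 (S.monotoneOn_φ ⟨h1, h2.trans h3⟩ ⟨h1.trans h2, h3⟩ h2)

theorem sub_le_one {u v : ℝ} (h1 : 0 ≤ u) (h2 : u ≤ v) (h3 : v ≤ S.T) : S.φ v - S.φ u ≤ 1 := by
  linarith [S.φ_total, S.sub_nonneg le_rfl h1 (h2.trans h3), S.sub_nonneg (h1.trans h2) h3 le_rfl]

theorem rpow_nonneg {u v : ℝ} (h1 : 0 ≤ u) (h2 : u ≤ v) (h3 : v ≤ S.T) (e : ℝ) :
    0 ≤ (S.φ v - S.φ u) ^ e :=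
  Real.rpow_nonneg (S.sub_nonneg h1 h2 h3) e

theorem rpow_le_one {u v : ℝ} (h1 : 0 ≤ u) (h2 : u ≤ v) (h3 : v ≤ S.T) {e : ℝ} (he : 0 ≤ e) :
    (S.φ v - S.φ u) ^ e ≤ 1 :=
  Real.rpow_le_one (S.sub_nonneg h1 h2 h3) (S.sub_le_one h1 h2 h3) he

theorem rpow_lam_le {u v : ℝ} (h1 : 0 ≤ u) (h2 : u ≤ v) (h3 : v ≤ S.T) :
    (S.φ v - S.φ u) ^ S.lam ≤ (S.φ v - S.φ u) ^ S.mu :=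
  Real.rpow_le_rpow_of_exponent_ge' (S.sub_nonneg h1 h2 h3) (S.sub_le_one h1 h2 h3)
    S.mu_pos.le S.mu_le_lam

/-- The constant of the Young–Loève estimate. -/
def C : ℝ := sewConst (S.lam + S.mu)

theorem C_nonneg : 0 ≤ S.C := sewConst_nonneg S.one_lt

theorem youngLoeve {G : ℝ → (Ed m →L[ℝ] Ed d)} {J : ℝ → Ed d} {a b K ρ : ℝ}
    (h : IsYoungPrimitive G S.ω J a b) (ha : 0 ≤ a) (hb : b ≤ S.T) (hK : 0 ≤ K) (hρ : 0 ≤ ρ)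
    (hG : ∀ u v, a ≤ u → u ≤ v → v ≤ b → ‖G v - G u‖ ≤ K * (S.φ v - S.φ u) ^ S.mu)
    (hω : ∀ u v, a ≤ u → u ≤ v → v ≤ b → ‖S.ω v - S.ω u‖ ≤ ρ * (S.φ v - S.φ u) ^ S.lam)
    {u v : ℝ} (hau : a ≤ u) (huv : u ≤ v) (hvb : v ≤ b) :
    ‖J v - J u - G u (S.ω v - S.ω u)‖ ≤ S.C * (K * ρ) * (S.φ v - S.φ u) ^ S.lam := by
  have hw : SuperaddOn a b (fun s t => S.φ t - S.φ s) :=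
    ⟨fun s t h1 h2 h3 => S.sub_nonneg (ha.trans h1) h2 (h3.trans hb),
      fun s u t _ _ _ _ => by simp⟩
  have h1 := h.norm_error_le S.one_lt (mul_nonneg hK hρ) hw (fun s u t h1 h2 h3 h4 => ?_)
    hau huv hvb
  · refine h1.trans ?_
    have := S.C_nonneg
    refine mul_le_mul_of_nonneg_left ?_ (mul_nonneg S.C_nonneg (mul_nonneg hK hρ))
    exact Real.rpow_le_rpow_of_exponent_ge' (S.sub_nonneg (ha.trans hau) huv (hvb.trans hb))
      (S.sub_le_one (ha.trans hau) huv (hvb.trans hb)) S.lam_pos.le (by linarith [S.mu_pos])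
  · have n0 := S.sub_nonneg (ha.trans h1) (h2.trans h3) (h4.trans hb)
    have n1 := S.sub_nonneg (ha.trans h1) h2 ((h3.trans h4).trans hb)
    have n2 := S.sub_nonneg (ha.trans (h1.trans h2)) h3 (h4.trans hb)
    rw [Real.rpow_add_of_nonneg n0 S.lam_pos.le S.mu_pos.le]
    calc _ ≤ (K * (S.φ u - S.φ s) ^ S.mu) * (ρ * (S.φ t - S.φ u) ^ S.lam) :=
          mul_le_mul (hG s u h1 h2 (h3.trans h4)) (hω u t (h1.trans h2) h3 h4) (norm_nonneg _)
            (mul_nonneg hK (Real.rpow_nonneg n1 _))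
      _ ≤ (K * (S.φ t - S.φ s) ^ S.mu) * (ρ * (S.φ t - S.φ s) ^ S.lam) := by
          have e1 := Real.rpow_le_rpow n1 (by linarith : S.φ u - S.φ s ≤ S.φ t - S.φ s)
            S.mu_pos.le
          have e2 := Real.rpow_le_rpow n2 (by linarith : S.φ t - S.φ u ≤ S.φ t - S.φ s)
            S.lam_pos.le
          have := Real.rpow_nonneg n2 S.lam
          have := Real.rpow_nonneg n0 S.mu
          gcongr
      _ = _ := by ring

/-- `x` solves the equation on `[a,b]` and has increments controlled by `φ`. -/
structure IsSol (x : ℝ → Ed d) (a b : ℝ) : Prop where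
  continuousOn : ContinuousOn x (Icc a b)
  exists_norm_sub_le : ∃ N : ℝ, 0 ≤ N ∧ ∀ u v, a ≤ u → u ≤ v → v ≤ b →
    ‖x v - x u‖ ≤ N * (S.φ v - S.φ u) ^ S.lam
  exists_primitive : ∃ J : ℝ → Ed d, IsYoungPrimitive (fun r => S.g r (x r)) S.ω J a b ∧
    ∀ u v, a ≤ u → u ≤ v → v ≤ b → x v - x u = (∫ r in u..v, S.f r (x r)) + (J v - J u)

variable {S}

theorem IsSol.mono_set {x : ℝ → Ed d} {a b a' b' : ℝ} (h : S.IsSol x a b) (ha : a ≤ a')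
    (hb : b' ≤ b) : S.IsSol x a' b' := by
  obtain ⟨h1, ⟨N, hN, h2⟩, ⟨J, h3, h4⟩⟩ := h
  exact ⟨h1.mono (Icc_subset_Icc ha hb),
    ⟨N, hN, fun u v e1 e2 e3 => h2 u v (ha.trans e1) e2 (e3.trans hb)⟩,
    ⟨J, h3.mono_set ha hb, fun u v e1 e2 e3 => h4 u v (ha.trans e1) e2 (e3.trans hb)⟩⟩

variable (S)

theorem exists_bound {E : Type*} [NormedAddCommGroup E] {k : ℝ → Ed d → E}
    (hk : Continuous (fun pr : ℝ × Ed d => k pr.1 pr.2)) (R : ℝ) :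
    ∃ B : ℝ, 0 ≤ B ∧ ∀ t x, 0 ≤ t → t ≤ S.T → ‖x‖ ≤ R → ‖k t x‖ ≤ B := by
  have hc : IsCompact (Icc 0 S.T ×ˢ Metric.closedBall (0 : Ed d) R) :=
    isCompact_Icc.prod (isCompact_closedBall _ _)
  obtain ⟨B, hB⟩ := hc.exists_bound_of_continuousOn hk.continuousOn
  exact ⟨max B 0, le_max_right _ _, fun t x h1 h2 h3 =>
    (hB (t, x) ⟨⟨h1, h2⟩, by simpa using h3⟩).trans (le_max_left _ _)⟩

theorem norm_g_path_sub_le {x : ℝ → Ed d} {u v : ℝ} (h1 : 0 ≤ u) (h2 : u ≤ v) (h3 : v ≤ S.T) :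
    ‖S.g v (x v) - S.g u (x u)‖ ≤ S.Lg * ‖x v - x u‖ + S.cH * (S.φ v - S.φ u) ^ S.mu := by
  have e := norm_add_le (S.g v (x v) - S.g v (x u)) (S.g v (x u) - S.g u (x u))
  rw [sub_add_sub_cancel] at e
  linarith [S.norm_g_sub_le v (x v) (x u), S.time_g u v h1 h2 h3 (x u)]

theorem intervalIntegrable_f {x : ℝ → Ed d} {a b u v : ℝ} (hx : ContinuousOn x (Icc a b))
    (h1 : a ≤ u) (h2 : u ≤ v) (h3 : v ≤ b) :
    IntervalIntegrable (fun r => S.f r (x r)) MeasureTheory.volume u v := by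
  apply ContinuousOn.intervalIntegrable
  rw [uIcc_of_le h2]
  have : ContinuousOn (fun r => (r, x r)) (Icc u v) :=
    continuousOn_id.prodMk (hx.mono (Icc_subset_Icc h1 h3))
  exact S.continuous_f.comp_continuousOn this

theorem norm_integral_le {k : ℝ → Ed d} {B u v : ℝ} (h2 : u ≤ v)
    (hB : ∀ r, u ≤ r → r ≤ v → ‖k r‖ ≤ B) : ‖∫ r in u..v, k r‖ ≤ B * (v - u) := by
  have := intervalIntegral.norm_integral_le_of_norm_le_const (a := u) (b := v) (f := k) (C := B)
    (fun r hr => by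
      rw [uIoc_of_le h2] at hr
      exact hB r hr.1.le hr.2)
  rwa [abs_of_nonneg (by linarith)] at this

/-- Solutions staying in a ball have uniformly controlled increments on short intervals. -/
theorem exists_apriori {R : ℝ} : ∃ η : ℝ, 0 < η ∧ ∃ N : ℝ, 0 ≤ N ∧
    ∀ (x : ℝ → Ed d) (a b : ℝ), 0 ≤ a → b ≤ S.T → b - a ≤ η → S.IsSol x a b →
      (∀ r, a ≤ r → r ≤ b → ‖x r‖ ≤ R) →
      ∀ u v, a ≤ u → u ≤ v → v ≤ b → ‖x v - x u‖ ≤ N * (S.φ v - S.φ u) ^ S.lam := by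
  obtain ⟨F, hF, hfF⟩ := S.exists_bound S.continuous_f R
  obtain ⟨M, hM, hgM⟩ := S.exists_bound S.continuous_g R
  have hC := S.C_nonneg
  have hL := S.Lg_nonneg
  have hcH := S.cH_nonneg
  have hCL : 0 ≤ S.C * S.Lg := mul_nonneg hC hL
  set ρ : ℝ := 1 / (2 * (S.C * S.Lg + 1)) with hρ
  have hρ0 : 0 < ρ := by positivity
  have hρ1 : ρ ≤ 1 := by
    rw [hρ, div_le_one (by positivity)]; linarith
  have hρ2 : ρ * (S.C * S.Lg) ≤ 1 / 2 := by
    rw [hρ, div_mul_eq_mul_div, div_le_div_iff₀ (by positivity) (by positivity)]; linarith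
  obtain ⟨η, hη, hsmall⟩ := S.small ρ hρ0
  have hA : 0 ≤ F + M + S.C * S.cH := by positivity
  refine ⟨η, hη, 2 * (F + M + S.C * S.cH), by positivity, ?_⟩
  intro x a b ha hb hab hx hR u v hau huv hvb
  obtain ⟨N₀, hN₀, hxN⟩ := hx.exists_norm_sub_le
  obtain ⟨J, hJ, hxJ⟩ := hx.exists_primitive
  let ι := {pr : ℝ × ℝ // a ≤ pr.1 ∧ pr.1 ≤ pr.2 ∧ pr.2 ≤ b}
  refine le_of_bootstrap (ι := ι) (a := fun i => ‖x i.1.2 - x i.1.1‖)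
    (c := fun i => (S.φ i.1.2 - S.φ i.1.1) ^ S.lam) hA hN₀
    (fun i => S.rpow_nonneg (ha.trans i.2.1) i.2.2.1 (i.2.2.2.trans hb) _)
    (fun i => hxN _ _ i.2.1 i.2.2.1 i.2.2.2) ?_ ⟨(u, v), hau, huv, hvb⟩
  rintro N hN hx' ⟨⟨u, v⟩, hau, huv, hvb⟩
  simp only at hau huv hvb ⊢
  have hsm : ∀ u v, a ≤ u → u ≤ v → v ≤ b → _ := fun u v h1 h2 h3 =>
    hsmall u v (ha.trans h1) h2 (h3.trans hb) (by linarith)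
  have hy := S.youngLoeve (K := S.Lg * N + S.cH) hJ ha hb (by positivity) hρ0.le
    (fun u v h1 h2 h3 => by
      have e1 := S.norm_g_path_sub_le (x := x) (ha.trans h1) h2 (h3.trans hb)
      have e2 : ‖x v - x u‖ ≤ N * (S.φ v - S.φ u) ^ S.lam := hx' ⟨(u, v), h1, h2, h3⟩
      have e3 := S.rpow_lam_le (ha.trans h1) h2 (h3.trans hb)
      calc _ ≤ _ := e1
        _ ≤ S.Lg * (N * (S.φ v - S.φ u) ^ S.mu) + S.cH * (S.φ v - S.φ u) ^ S.mu := by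
          gcongr; exact e2.trans (by gcongr)
        _ = _ := by ring)
    (fun u v h1 h2 h3 => (hsm u v h1 h2 h3).1) hau huv hvb
  obtain ⟨e1, e2⟩ := hsm u v hau huv hvb
  set W := (S.φ v - S.φ u) ^ S.lam with hW
  have hW0 : 0 ≤ W := S.rpow_nonneg (ha.trans hau) huv (hvb.trans hb) _
  have e3 : ‖∫ r in u..v, S.f r (x r)‖ ≤ F * (v - u) :=
    norm_integral_le huv fun r h1 h2 =>
      hfF r (x r) (ha.trans (hau.trans h1)) (h2.trans (hvb.trans hb))
        (hR r (hau.trans h1) (h2.trans hvb))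
  have e4 : ‖S.g u (x u) (S.ω v - S.ω u)‖ ≤ M * (ρ * W) :=
    (ContinuousLinearMap.le_opNorm _ _).trans (mul_le_mul
      (hgM u (x u) (ha.trans hau) (huv.trans (hvb.trans hb)) (hR u hau (huv.trans hvb))) e1
      (norm_nonneg _) hM)
  have e5 : x v - x u = (∫ r in u..v, S.f r (x r)) + (S.g u (x u) (S.ω v - S.ω u) +
      (J v - J u - S.g u (x u) (S.ω v - S.ω u))) := by
    rw [hxJ u v hau huv hvb, add_sub_cancel]
  rw [e5]
  calc _ ≤ F * (v - u) + (M * (ρ * W) + S.C * ((S.Lg * N + S.cH) * ρ) * W) :=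
        (norm_add_le _ _).trans (add_le_add e3 ((norm_add_le _ _).trans (add_le_add e4 hy)))
    _ ≤ F * (ρ * W) + (M * (ρ * W) + S.C * ((S.Lg * N + S.cH) * ρ) * W) := by gcongr
    _ = (ρ * (F + M + S.C * S.cH) + ρ * (S.C * S.Lg) * N) * W := by ring
    _ ≤ (1 * (F + M + S.C * S.cH) + 1 / 2 * N) * W := by gcongr
    _ = _ := by ring

theorem norm_Dg_le (t : ℝ) (x : Ed d) : ‖S.Dg t x‖ ≤ S.Lg := by
  refine (S.hasFDerivAt_g t x).le_of_lip' S.Lg_nonneg (Filter.Eventually.of_forall fun y => ?_)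
  exact S.norm_g_sub_le t y x

/-- Second order increments of `g`. -/
theorem norm_g_rect_le {R M s t E : ℝ} (hs : 0 ≤ s) (hst : s ≤ t) (ht : t ≤ S.T)
    (hM0 : 0 ≤ M) (hM : ∀ t x y, ‖x‖ ≤ R → ‖y‖ ≤ R → ‖S.Dg t x - S.Dg t y‖ ≤ M * ‖x - y‖ ^ S.δ)
    {x₀ x₁ y₀ y₁ : Ed d} (hx₀ : ‖x₀‖ ≤ R) (hx₁ : ‖x₁‖ ≤ R) (hy₀ : ‖y₀‖ ≤ R) (hy₁ : ‖y₁‖ ≤ R)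
    (hx : ‖x₁ - x₀‖ ≤ E) (hy : ‖y₁ - y₀‖ ≤ E) :
    ‖(S.g t x₁ - S.g t y₁) - (S.g s x₀ - S.g s y₀)‖ ≤
      S.Lg * ‖(x₁ - y₁) - (x₀ - y₀)‖ +
        (M * E ^ S.δ + S.cH * (S.φ t - S.φ s) ^ S.mu) * ‖x₀ - y₀‖ := by
  let ψ : ℝ → (Ed m →L[ℝ] Ed d) := fun θ =>
    S.g t (y₁ + θ • (x₁ - y₁)) - S.g s (y₀ + θ • (x₀ - y₀))
  have hline : ∀ (y z : Ed d) (θ : ℝ), HasDerivAt (fun θ : ℝ => y + θ • z) z θ := by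
    intro y z θ
    simpa using ((hasDerivAt_id θ).smul_const z).const_add y
  have hψ : ∀ θ : ℝ, HasDerivAt ψ (S.Dg t (y₁ + θ • (x₁ - y₁)) (x₁ - y₁) -
      S.Dg s (y₀ + θ • (x₀ - y₀)) (x₀ - y₀)) θ := fun θ =>
    ((S.hasFDerivAt_g t _).comp_hasDerivAt θ (hline _ _ θ)).sub
      ((S.hasFDerivAt_g s _).comp_hasDerivAt θ (hline _ _ θ))
  have hball : ∀ (x y : Ed d) (r : ℝ) (θ : ℝ), 0 ≤ θ → θ ≤ 1 → ‖x‖ ≤ r → ‖y‖ ≤ r →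
      ‖y + θ • (x - y)‖ ≤ r := by
    intro x y r θ h0 h1 hx hy
    have : y + θ • (x - y) = (1 - θ) • y + θ • x := by module
    rw [this]
    refine (norm_add_le _ _).trans ?_
    rw [norm_smul, norm_smul, Real.norm_of_nonneg h0, Real.norm_of_nonneg (by linarith)]
    nlinarith
  have key := norm_image_sub_le_of_norm_deriv_le_segment_01' (f := ψ)
    (C := S.Lg * ‖(x₁ - y₁) - (x₀ - y₀)‖ +
        (M * E ^ S.δ + S.cH * (S.φ t - S.φ s) ^ S.mu) * ‖x₀ - y₀‖)
    (fun θ _ => (hψ θ).hasDerivWithinAt) (fun θ hθ => ?_)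
  · have h1 : ψ 1 - ψ 0 = (S.g t x₁ - S.g t y₁) - (S.g s x₀ - S.g s y₀) := by
      simp only [ψ, one_smul, zero_smul, add_sub_cancel, add_zero]
      abel
    rwa [h1] at key
  · set p₁ := y₁ + θ • (x₁ - y₁) with hp₁
    set p₀ := y₀ + θ • (x₀ - y₀) with hp₀
    have hp : ‖p₁ - p₀‖ ≤ E := by
      have : p₁ - p₀ = (y₁ - y₀) + θ • ((x₁ - x₀) - (y₁ - y₀)) := by
        simp only [hp₁, hp₀]; module
      rw [this]
      exact hball _ _ _ _ hθ.1 hθ.2.le hx hy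
    have e1 : ‖S.Dg t p₁ - S.Dg t p₀‖ ≤ M * E ^ S.δ :=
      (hM t p₁ p₀ (hball _ _ _ _ hθ.1 hθ.2.le hx₁ hy₁) (hball _ _ _ _ hθ.1 hθ.2.le hx₀ hy₀)).trans
        (mul_le_mul_of_nonneg_left (Real.rpow_le_rpow (norm_nonneg _) hp S.δ_pos.le) hM0)
    have e2 := S.time_Dg s t hs hst ht p₀
    have e3 : ‖S.Dg t p₁ - S.Dg s p₀‖ ≤ M * E ^ S.δ + S.cH * (S.φ t - S.φ s) ^ S.mu := by
      linarith [norm_sub_le_norm_sub_add_norm_sub (S.Dg t p₁) (S.Dg t p₀) (S.Dg s p₀)]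
    have e4 : S.Dg t p₁ (x₁ - y₁) - S.Dg s p₀ (x₀ - y₀) =
        S.Dg t p₁ ((x₁ - y₁) - (x₀ - y₀)) + (S.Dg t p₁ - S.Dg s p₀) (x₀ - y₀) := by
      simp only [map_sub, sub_apply]; abel
    rw [e4]
    refine (norm_add_le _ _).trans (add_le_add ?_ ?_)
    · exact (ContinuousLinearMap.le_opNorm _ _).trans
        (mul_le_mul_of_nonneg_right (S.norm_Dg_le _ _) (norm_nonneg _))
    · exact (ContinuousLinearMap.le_opNorm _ _).trans
        (mul_le_mul_of_nonneg_right e3 (norm_nonneg _))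

/-- Two solutions staying in a ball remain close on short intervals. -/
theorem exists_local_diff {R : ℝ} (hR : 0 ≤ R) : ∃ η : ℝ, 0 < η ∧
    ∀ (x y : ℝ → Ed d) (a b : ℝ), 0 ≤ a → b ≤ S.T → b - a ≤ η → S.IsSol x a b → S.IsSol y a b →
      (∀ r, a ≤ r → r ≤ b → ‖x r‖ ≤ R) → (∀ r, a ≤ r → r ≤ b → ‖y r‖ ≤ R) →
      ∀ w r, w ∈ Icc a b → r ∈ Icc a b → ‖x r - y r‖ ≤ 2 * ‖x w - y w‖ := by
  obtain ⟨η₁, hη₁, N, hN, hap⟩ := S.exists_apriori (R := R)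
  obtain ⟨L, hL, hfL⟩ := S.lipschitz_f R hR
  obtain ⟨M, hM, hgM⟩ := S.holder_Dg R hR
  have hC := S.C_nonneg
  have hLg := S.Lg_nonneg
  have hcH := S.cH_nonneg
  set cD : ℝ := M * N ^ S.δ + S.cH with hcD
  have hcD0 : 0 ≤ cD := by positivity
  set Q : ℝ := L + S.Lg + S.C * cD + S.C * S.Lg + 1 with hQ
  have hCL : 0 ≤ S.C * S.Lg := mul_nonneg hC hLg
  have hCc : 0 ≤ S.C * cD := mul_nonneg hC hcD0
  have hQ0 : 0 < Q := by positivity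
  set ρ : ℝ := 1 / (4 * Q) with hρ
  have hρ0 : 0 < ρ := by positivity
  have hρQ : ρ * Q = 1 / 4 := by rw [hρ]; field_simp
  have hρ1 : ρ * (S.C * S.Lg) ≤ 1 / 2 := by nlinarith
  have hρ2 : ρ * (L + S.Lg + S.C * cD) ≤ 1 / 4 := by nlinarith
  obtain ⟨η₂, hη₂, hsmall⟩ := S.small ρ hρ0
  refine ⟨min η₁ η₂, lt_min hη₁ hη₂, ?_⟩
  intro x y a b ha hb hab hx hy hxR hyR w r hw hr
  have hle : a ≤ b := hw.1.trans hw.2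
  have hcont : ContinuousOn (fun r => ‖x r - y r‖) (Icc a b) :=
    (hx.continuousOn.sub hy.continuousOn).norm
  obtain ⟨r₀, hr₀, hmax⟩ := isCompact_Icc.exists_isMaxOn ⟨w, hw⟩ hcont
  set D := ‖x r₀ - y r₀‖ with hD
  have hD0 : 0 ≤ D := norm_nonneg _
  have hmax' : ∀ r, a ≤ r → r ≤ b → ‖x r - y r‖ ≤ D := fun r h1 h2 => hmax ⟨h1, h2⟩
  have hxN := hap x a b ha hb (hab.trans (min_le_left _ _)) hx hxR
  have hyN := hap y a b ha hb (hab.trans (min_le_left _ _)) hy hyR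
  obtain ⟨J, hJ, hxJ⟩ := hx.exists_primitive
  obtain ⟨J', hJ', hyJ⟩ := hy.exists_primitive
  have hsm : ∀ u v, a ≤ u → u ≤ v → v ≤ b → _ := fun u v h1 h2 h3 =>
    hsmall u v (ha.trans h1) h2 (h3.trans hb)
      (by linarith [hab.trans (min_le_right _ _)])
  have hinc : ∀ u v, a ≤ u → u ≤ v → v ≤ b →
      ‖(x v - y v) - (x u - y u)‖ ≤ 2 * (D / 4) * (S.φ v - S.φ u) ^ S.lam := by
    intro u v hau huv hvb
    let ι := {pr : ℝ × ℝ // a ≤ pr.1 ∧ pr.1 ≤ pr.2 ∧ pr.2 ≤ b}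
    refine le_of_bootstrap (ι := ι) (a := fun i => ‖(x i.1.2 - y i.1.2) - (x i.1.1 - y i.1.1)‖)
      (c := fun i => (S.φ i.1.2 - S.φ i.1.1) ^ S.lam) (N₀ := N + N) (by positivity)
      (by positivity)
      (fun i => S.rpow_nonneg (ha.trans i.2.1) i.2.2.1 (i.2.2.2.trans hb) _)
      ?_ ?_ ⟨(u, v), hau, huv, hvb⟩
    · rintro ⟨⟨u, v⟩, hau, huv, hvb⟩
      simp only at hau huv hvb ⊢
      have e : (x v - y v) - (x u - y u) = (x v - x u) - (y v - y u) := by abel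
      rw [e, add_mul]
      exact (norm_sub_le _ _).trans (add_le_add (hxN u v hau huv hvb) (hyN u v hau huv hvb))
    rintro K hK hz ⟨⟨u, v⟩, hau, huv, hvb⟩
    simp only at hau huv hvb ⊢
    have hyl := S.youngLoeve (K := S.Lg * K + cD * D) (hJ.sub hJ') ha hb (by positivity) hρ0.le
      (fun u v h1 h2 h3 => by
        have n0 := S.sub_nonneg (ha.trans h1) h2 (h3.trans hb)
        have e1 := S.norm_g_rect_le (ha.trans h1) h2 (h3.trans hb) hM hgM
          (hxR u h1 (h2.trans h3)) (hxR v (h1.trans h2) h3) (hyR u h1 (h2.trans h3))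
          (hyR v (h1.trans h2) h3) (hxN u v h1 h2 h3) (hyN u v h1 h2 h3)
        have e2 : ‖(x v - y v) - (x u - y u)‖ ≤ K * (S.φ v - S.φ u) ^ S.lam :=
          hz ⟨(u, v), h1, h2, h3⟩
        have e3 := S.rpow_lam_le (ha.trans h1) h2 (h3.trans hb)
        have e4 : (N * (S.φ v - S.φ u) ^ S.lam) ^ S.δ ≤ N ^ S.δ * (S.φ v - S.φ u) ^ S.mu := by
          rw [Real.mul_rpow hN (Real.rpow_nonneg n0 _), ← Real.rpow_mul n0]
          refine mul_le_mul_of_nonneg_left ?_ (Real.rpow_nonneg hN _)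
          exact Real.rpow_le_rpow_of_exponent_ge' n0
            (S.sub_le_one (ha.trans h1) h2 (h3.trans hb)) S.mu_pos.le S.mu_le_lam_mul
        have e5 := Real.rpow_nonneg n0 S.mu
        calc _ ≤ _ := e1
          _ ≤ S.Lg * (K * (S.φ v - S.φ u) ^ S.mu) +
              (M * (N ^ S.δ * (S.φ v - S.φ u) ^ S.mu) + S.cH * (S.φ v - S.φ u) ^ S.mu) * D := by
            have e6 := hmax' u h1 (h2.trans h3)
            have e7 : K * (S.φ v - S.φ u) ^ S.lam ≤ K * (S.φ v - S.φ u) ^ S.mu := by gcongr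
            have e8 := e2.trans e7
            gcongr
          _ = _ := by ring)
      (fun u v h1 h2 h3 => (hsm u v h1 h2 h3).1) hau huv hvb
    obtain ⟨e1, e2⟩ := hsm u v hau huv hvb
    set W := (S.φ v - S.φ u) ^ S.lam with hW
    have hW0 : 0 ≤ W := S.rpow_nonneg (ha.trans hau) huv (hvb.trans hb) _
    have e3 : ‖(∫ r in u..v, S.f r (x r)) - ∫ r in u..v, S.f r (y r)‖ ≤ L * D * (v - u) := by
      rw [← intervalIntegral.integral_sub
        (S.intervalIntegrable_f hx.continuousOn hau huv hvb)
        (S.intervalIntegrable_f hy.continuousOn hau huv hvb)]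
      refine norm_integral_le huv fun r h1 h2 => ?_
      exact (hfL r _ _ (hxR r (hau.trans h1) (h2.trans hvb))
        (hyR r (hau.trans h1) (h2.trans hvb))).trans
        (mul_le_mul_of_nonneg_left (hmax' r (hau.trans h1) (h2.trans hvb)) hL)
    have e4 : ‖(S.g u (x u) - S.g u (y u)) (S.ω v - S.ω u)‖ ≤ S.Lg * D * (ρ * W) :=
      (ContinuousLinearMap.le_opNorm _ _).trans (mul_le_mul
        ((S.norm_g_sub_le u _ _).trans
          (mul_le_mul_of_nonneg_left (hmax' u hau (huv.trans hvb)) hLg)) e1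
        (norm_nonneg _) (by positivity))
    have e5 : (x v - y v) - (x u - y u) =
        ((∫ r in u..v, S.f r (x r)) - ∫ r in u..v, S.f r (y r)) +
        ((S.g u (x u) - S.g u (y u)) (S.ω v - S.ω u) +
        (J v - J' v - (J u - J' u) - (S.g u (x u) - S.g u (y u)) (S.ω v - S.ω u))) := by
      have h1 := hxJ u v hau huv hvb
      have h2 := hyJ u v hau huv hvb
      rw [add_sub_cancel]
      calc (x v - y v) - (x u - y u) = (x v - x u) - (y v - y u) := by abel
        _ = _ := by rw [h1, h2]; abel
    rw [e5]
    calc _ ≤ L * D * (v - u) + (S.Lg * D * (ρ * W) + S.C * ((S.Lg * K + cD * D) * ρ) * W) :=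
          (norm_add_le _ _).trans (add_le_add e3 ((norm_add_le _ _).trans (add_le_add e4 hyl)))
      _ ≤ L * D * (ρ * W) + (S.Lg * D * (ρ * W) + S.C * ((S.Lg * K + cD * D) * ρ) * W) := by
          gcongr
      _ = (ρ * (L + S.Lg + S.C * cD) * D + ρ * (S.C * S.Lg) * K) * W := by ring
      _ ≤ (1 / 4 * D + 1 / 2 * K) * W := by gcongr
      _ = _ := by ring
  have hhalf : ‖(x r₀ - y r₀) - (x w - y w)‖ ≤ D / 2 := by
    rcases le_total w r₀ with h | h
    · have h1 := hinc w r₀ hw.1 h hr₀.2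
      have h2 := S.rpow_le_one (ha.trans hw.1) h (hr₀.2.trans hb) S.lam_pos.le
      nlinarith
    · have h1 := hinc r₀ w hr₀.1 h hw.2
      have h2 := S.rpow_le_one (ha.trans hr₀.1) h (hw.2.trans hb) S.lam_pos.le
      rw [norm_sub_rev] at h1
      nlinarith
  have h3 := norm_sub_norm_le (x r₀ - y r₀) (x w - y w)
  have h4 := hmax' r hr.1 hr.2
  linarith

/-- A version of the local estimate where only one of the solutions is known to be bounded. -/
theorem exists_local_diff_of_small {R : ℝ} (hR : 0 ≤ R) : ∃ η : ℝ, 0 < η ∧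
    ∀ (x y : ℝ → Ed d) (a b : ℝ), 0 ≤ a → b ≤ S.T → b - a ≤ η → S.IsSol x a b → S.IsSol y a b →
      (∀ r, a ≤ r → r ≤ b → ‖x r‖ ≤ R) → ∀ w r, w ∈ Icc a b → r ∈ Icc a b →
      2 * ‖x w - y w‖ < 1 → ‖x r - y r‖ ≤ 2 * ‖x w - y w‖ := by
  obtain ⟨η, hη, h⟩ := S.exists_local_diff (R := R + 1) (by linarith)
  refine ⟨η, hη, ?_⟩
  intro x y a b ha hb hab hx hy hxR w r hw hr hsmall
  have hcont : ContinuousOn (fun r => ‖x r - y r‖) (Icc a b) :=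
    (hx.continuousOn.sub hy.continuousOn).norm
  have key : ∀ c, c ∈ Icc a b → (∀ r ∈ uIcc w c, ‖x r - y r‖ ≤ 1) →
      ∀ r ∈ uIcc w c, ‖x r - y r‖ ≤ 2 * ‖x w - y w‖ := by
    intro c hc hle r hr
    have hsub : uIcc w c ⊆ Icc a b := uIcc_subset_Icc hw hc
    have h1 : a ≤ min w c := le_min hw.1 hc.1
    have h2 : max w c ≤ b := max_le hw.2 hc.2
    refine h x y (min w c) (max w c) (ha.trans h1) (h2.trans hb) (by linarith)
      (hx.mono_set h1 h2) (hy.mono_set h1 h2)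
      (fun r h3 h4 => (hxR r (h1.trans h3) (h4.trans h2)).trans (by linarith))
      (fun r h3 h4 => ?_) w r left_mem_uIcc hr
    have h5 := hle r ⟨h3, h4⟩
    have h6 := hxR r (h1.trans h3) (h4.trans h2)
    have h7 := norm_sub_norm_le (y r) (x r)
    rw [norm_sub_rev] at h7
    linarith
  have hw1 : ‖x w - y w‖ < 1 := by linarith [norm_nonneg (x w - y w)]
  have hlt : ∀ c ∈ Icc a b, ‖x c - y c‖ < 1 := by
    by_contra! hex
    obtain ⟨c₀, hc₀, hc₀1⟩ := hex
    have hcomp : IsCompact {c ∈ Icc a b | 1 ≤ ‖x c - y c‖} := by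
      have : IsClosed (Icc a b ∩ (fun c => ‖x c - y c‖) ⁻¹' Ici 1) :=
        hcont.preimage_isClosed_of_isClosed isClosed_Icc isClosed_Ici
      exact isCompact_Icc.of_isClosed_subset this fun c hc => hc.1
    obtain ⟨c, ⟨hc, hc1⟩, hmin⟩ := hcomp.exists_isMinOn ⟨c₀, hc₀, hc₀1⟩
      (f := fun c => |c - w|) (by fun_prop)
    have hsub : uIcc w c ⊆ Icc a b := uIcc_subset_Icc hw hc
    have habs : ∀ r ∈ uIcc w c, |r - w| ≤ |c - w| := fun r hr =>
      abs_sub_left_of_mem_uIcc hr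
    have heq : ∀ r ∈ uIcc w c, |c - w| ≤ |r - w| → r = c := by
      intro r hr hle
      rcases le_total w c with hwc | hwc
      · rw [uIcc_of_le hwc] at hr
        rw [abs_of_nonneg (by linarith), abs_of_nonneg (by linarith [hr.1])] at hle
        linarith [hr.2]
      · rw [uIcc_of_ge hwc] at hr
        rw [abs_of_nonpos (by linarith), abs_of_nonpos (by linarith [hr.2])] at hle
        linarith [hr.1]
    obtain ⟨c', hc', hc'1⟩ := intermediate_value_uIcc (hcont.mono hsub)
      (show (1 : ℝ) ∈ uIcc _ _ from by rw [uIcc_of_le (hw1.le.trans hc1)]; exact ⟨hw1.le, hc1⟩)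
    simp only at hc'1
    have hcc : c' = c := heq c' hc' (hmin ⟨hsub hc', hc'1.ge⟩)
    have hbd : ∀ r ∈ uIcc w c, ‖x r - y r‖ ≤ 1 := by
      intro r hr
      by_contra! hr1
      have := heq r hr (hmin ⟨hsub hr, hr1.le⟩)
      rw [this, ← hcc, hc'1] at hr1
      exact lt_irrefl _ hr1
    linarith [key c hc hbd c right_mem_uIcc]
  have hsub : uIcc w r ⊆ Icc a b := uIcc_subset_Icc hw hr
  exact key r hr (fun r' hr' => (hlt r' (hsub hr')).le) r right_mem_uIcc

/-- Stability of solutions with respect to the value at any given time. -/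
theorem exists_stability {R : ℝ} (hR : 0 ≤ R) : ∃ K : ℝ, 0 < K ∧
    ∀ (x y : ℝ → Ed d) (a b : ℝ), 0 ≤ a → b ≤ S.T → S.IsSol x a b → S.IsSol y a b →
      (∀ r, a ≤ r → r ≤ b → ‖x r‖ ≤ R) → ∀ w r, w ∈ Icc a b → r ∈ Icc a b →
      K * ‖x w - y w‖ < 1 → ‖x r - y r‖ ≤ K * ‖x w - y w‖ := by
  obtain ⟨η, hη, h⟩ := S.exists_local_diff_of_small hR
  obtain ⟨n₀, hn₀⟩ := exists_nat_ge (S.T / η)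
  refine ⟨2 ^ n₀, by positivity, ?_⟩
  intro x y a b ha hb hx hy hxR w r hw hr hsmall
  have key : ∀ n : ℕ, ∀ r ∈ Icc a b, |r - w| ≤ n * η → 2 ^ n * ‖x w - y w‖ < 1 →
      ‖x r - y r‖ ≤ 2 ^ n * ‖x w - y w‖ := by
    intro n
    induction n with
    | zero =>
      intro r _ h1 _
      have : r = w := by
        rw [Nat.cast_zero, zero_mul] at h1
        linarith [abs_eq_zero.1 (le_antisymm h1 (abs_nonneg _))]
      simp [this]
    | succ n ih =>
      intro r hr h1 h2
      rw [pow_succ] at h2 ⊢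
      push_cast at h1
      have h2n : (0 : ℝ) ≤ 2 ^ n * ‖x w - y w‖ := by positivity
      obtain ⟨c, hc, hc1, hc2⟩ : ∃ c ∈ uIcc w r, |c - w| ≤ n * η ∧ |r - c| ≤ η := by
        have hn : (0 : ℝ) < n + 1 := by positivity
        have e1 : (n / (n + 1) : ℝ) ≤ 1 := by rw [div_le_one hn]; linarith
        have e0 : (0 : ℝ) ≤ n / (n + 1) := by positivity
        refine ⟨w + n / (n + 1) * (r - w), ?_, ?_, ?_⟩
        · rcases le_total w r with hwr | hwr
          · rw [uIcc_of_le hwr]; constructor <;> nlinarith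
          · rw [uIcc_of_ge hwr]; constructor <;> nlinarith
        · rw [add_sub_cancel_left, abs_mul, abs_of_nonneg e0, div_mul_eq_mul_div, div_le_iff₀ hn]
          nlinarith [Nat.cast_nonneg (α := ℝ) n]
        · have : r - (w + n / (n + 1) * (r - w)) = (r - w) / (n + 1) := by field_simp; ring
          rw [this, abs_div, abs_of_pos hn, div_le_iff₀ hn]
          linarith
      have hcI : c ∈ Icc a b := uIcc_subset_Icc hw hr hc
      have e1 := ih c hcI hc1 (by linarith)
      have e2 : a ≤ min c r := le_min hcI.1 hr.1
      have e3 : max c r ≤ b := max_le hcI.2 hr.2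
      have e4 : max c r - min c r ≤ η := by
        rw [max_sub_min_eq_abs]; exact hc2
      have e5 := h x y (min c r) (max c r) (ha.trans e2) (e3.trans hb) e4 (hx.mono_set e2 e3)
        (hy.mono_set e2 e3) (fun r h1 h2 => hxR r (e2.trans h1) (h2.trans e3)) c r
        left_mem_uIcc right_mem_uIcc (by linarith)
      linarith
  refine key n₀ r hr ?_ hsmall
  rw [div_le_iff₀ hη] at hn₀
  rw [abs_le]
  constructor <;> linarith [hw.1, hw.2, hr.1, hr.2]

variable {S} in
theorem IsSol.exists_bound {x : ℝ → Ed d} {a b : ℝ} (hx : S.IsSol x a b) :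
    ∃ R : ℝ, 0 ≤ R ∧ ∀ r, a ≤ r → r ≤ b → ‖x r‖ ≤ R := by
  obtain ⟨B, hB⟩ := isCompact_Icc.exists_bound_of_continuousOn hx.continuousOn
  exact ⟨max B 0, le_max_right _ _, fun r h1 h2 => (hB r ⟨h1, h2⟩).trans (le_max_left _ _)⟩

variable {S} in
theorem IsSol.eqOn {x y : ℝ → Ed d} {a b : ℝ} (ha : 0 ≤ a) (hb : b ≤ S.T) (hx : S.IsSol x a b)
    (hy : S.IsSol y a b) {w : ℝ} (hw : w ∈ Icc a b) (hxy : x w = y w) : EqOn x y (Icc a b) := by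
  obtain ⟨R, hR, hxR⟩ := hx.exists_bound
  obtain ⟨K, -, h⟩ := S.exists_stability hR
  intro r hr
  have := h x y a b ha hb hx hy hxR w r hw hr (by simp [hxy])
  rw [hxy, sub_self, norm_zero, mul_zero] at this
  exact sub_eq_zero.1 (norm_le_zero_iff.1 this)

end YoungSystem

theorem rpow_le_rpow_sub_mul_rpow {x A e ν : ℝ} (hx : 0 ≤ x) (hxA : x ≤ A) (hν : 0 < ν)
    (hνe : ν ≤ e) : x ^ e ≤ A ^ (e - ν) * x ^ ν := by
  have h := Real.rpow_le_rpow hx hxA (sub_nonneg.2 hνe : 0 ≤ e - ν)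
  calc x ^ e = x ^ (e - ν) * x ^ ν := by
        rw [← Real.rpow_add_of_nonneg hx (sub_nonneg.2 hνe) hν.le, sub_add_cancel]
    _ ≤ _ := mul_le_mul_of_nonneg_right h (Real.rpow_nonneg hx _)

theorem rpow_mul_rpow_le {x y A ν l : ℝ} (hx : 0 ≤ x) (hy : 0 ≤ y) (hA : x + y ≤ A) (hν : 0 < ν)
    (hl : 0 < l) (h1 : 1 ≤ ν + l) : x ^ ν * y ^ l ≤ A ^ (ν + l - 1) * (x + y) := by
  have hxy : 0 ≤ x + y := add_nonneg hx hy
  calc x ^ ν * y ^ l ≤ (x + y) ^ ν * (x + y) ^ l := by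
        have e1 := Real.rpow_le_rpow hx (le_add_of_nonneg_right hy) hν.le
        have e2 := Real.rpow_le_rpow hy (le_add_of_nonneg_left hx) hl.le
        have := Real.rpow_nonneg hxy ν
        have := Real.rpow_nonneg hy l
        gcongr
    _ = (x + y) ^ (ν + l) := (Real.rpow_add_of_nonneg hxy hν.le hl.le).symm
    _ ≤ _ := by
        have := rpow_le_rpow_sub_mul_rpow hxy hA one_pos h1
        rwa [Real.rpow_one] at this

namespace YoungSystem

variable {d m : ℕ} (S : YoungSystem d m)

/-- Existence of the Young integral of a path controlled by a monotone function. -/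
theorem exists_youngPrimitive {G : ℝ → (Ed m →L[ℝ] Ed d)} {ψ : ℝ → ℝ} {a b c ν : ℝ} (ha : 0 ≤ a)
    (hb : b ≤ S.T) (hν : 0 < ν) (h1 : 1 < ν + S.lam) (hc : 0 ≤ c) (hψ : MonotoneOn ψ (Icc a b))
    (hG : ∀ u v, a ≤ u → u ≤ v → v ≤ b → ‖G v - G u‖ ≤ c * (ψ v - ψ u) ^ ν) :
    ∃ J : ℝ → Ed d, IsYoungPrimitive G S.ω J a b ∧
      (∀ u ∈ Icc a b, youngIntegral G S.ω a u = J u - J a) ∧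
      ∃ N : ℝ, 0 ≤ N ∧ ∀ u v, a ≤ u → u ≤ v → v ≤ b →
        ‖J v - J u - G u (S.ω v - S.ω u)‖ ≤ N * (S.φ v - S.φ u) ^ S.lam := by
  have hl := S.lam_pos
  set κ : ℝ := ν + S.lam with hκ
  have hκ0 : 0 < κ := by linarith
  have hφ : MonotoneOn S.φ (Icc a b) := S.monotoneOn_φ.mono (Icc_subset_Icc ha hb)
  have nψ : ∀ u v, a ≤ u → u ≤ v → v ≤ b → 0 ≤ ψ v - ψ u := fun u v e1 e2 e3 =>
    _root_.sub_nonneg.2 (hψ ⟨e1, e2.trans e3⟩ ⟨e1.trans e2, e3⟩ e2)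
  have nφ : ∀ u v, a ≤ u → u ≤ v → v ≤ b → 0 ≤ S.φ v - S.φ u := fun u v e1 e2 e3 =>
    S.sub_nonneg (ha.trans e1) e2 (e3.trans hb)
  have hw : SuperaddOn a b
      (fun s t => (ψ t - ψ s) ^ (ν / κ) * (S.φ t - S.φ s) ^ (S.lam / κ)) :=
    SuperaddOn.mul_rpow hψ hφ (div_pos hν hκ0) (div_pos hl hκ0) (by
      rw [← add_div, div_self hκ0.ne'])
  have hwκ : ∀ u v, a ≤ u → u ≤ v → v ≤ b →
      ((ψ v - ψ u) ^ (ν / κ) * (S.φ v - S.φ u) ^ (S.lam / κ)) ^ κ =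
        (ψ v - ψ u) ^ ν * (S.φ v - S.φ u) ^ S.lam := fun u v e1 e2 e3 => by
    have n1 := nψ u v e1 e2 e3
    have n2 := nφ u v e1 e2 e3
    rw [Real.mul_rpow (Real.rpow_nonneg n1 _) (Real.rpow_nonneg n2 _), ← Real.rpow_mul n1,
      ← Real.rpow_mul n2, div_mul_cancel₀ _ hκ0.ne', div_mul_cancel₀ _ hκ0.ne']
  have defect : ∀ a' b' ρ, 0 ≤ ρ → a ≤ a' → b' ≤ b →
      (∀ u v, a' ≤ u → u ≤ v → v ≤ b' → ‖S.ω v - S.ω u‖ ≤ ρ * (S.φ v - S.φ u) ^ S.lam) →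
      ∀ s u t, a' ≤ s → s ≤ u → u ≤ t → t ≤ b' →
        ‖G s (S.ω t - S.ω s) - G s (S.ω u - S.ω s) - G u (S.ω t - S.ω u)‖ ≤
          c * ρ * ((ψ t - ψ s) ^ (ν / κ) * (S.φ t - S.φ s) ^ (S.lam / κ)) ^ κ := by
    intro a' b' ρ hρ ha' hb' hω s u t e1 e2 e3 e4
    refine IsYoungPrimitive.norm_defect_le.trans ?_
    rw [hwκ s t (ha'.trans e1) (e2.trans e3) (e4.trans hb')]
    have m1 := nψ s u (ha'.trans e1) e2 (e3.trans (e4.trans hb'))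
    have m2 := nψ u t (ha'.trans (e1.trans e2)) e3 (e4.trans hb')
    have m3 := nφ s u (ha'.trans e1) e2 (e3.trans (e4.trans hb'))
    have m4 := nφ u t (ha'.trans (e1.trans e2)) e3 (e4.trans hb')
    calc _ ≤ (c * (ψ u - ψ s) ^ ν) * (ρ * (S.φ t - S.φ u) ^ S.lam) :=
          mul_le_mul (hG s u (ha'.trans e1) e2 (e3.trans (e4.trans hb')))
            (hω u t (e1.trans e2) e3 e4) (norm_nonneg _)
            (mul_nonneg hc (Real.rpow_nonneg m1 _))
      _ ≤ (c * (ψ t - ψ s) ^ ν) * (ρ * (S.φ t - S.φ s) ^ S.lam) := by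
          have q1 := Real.rpow_le_rpow m1 (by linarith : ψ u - ψ s ≤ ψ t - ψ s) hν.le
          have q2 := Real.rpow_le_rpow m4 (by linarith : S.φ t - S.φ u ≤ S.φ t - S.φ s) hl.le
          have := Real.rpow_nonneg m4 S.lam
          have := Real.rpow_nonneg m1 ν
          have : 0 ≤ (ψ t - ψ s) ^ ν := by linarith
          gcongr
      _ = _ := by ring
  obtain ⟨J, hJ⟩ := exists_sewing (Ξ := fun s t => G s (S.ω t - S.ω s)) h1
    (mul_nonneg hc S.cω_nonneg) hw (by simp) (defect a b S.cω S.cω_nonneg le_rfl le_rfl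
      fun u v e1 e2 e3 => S.norm_ω_sub_le u v (ha.trans e1) e2 (e3.trans hb))
  have hC := sewConst_nonneg h1
  set A : ℝ := (ψ b - ψ a) + (S.φ b - S.φ a) with hA
  have hmix : ∀ u v, a ≤ u → u ≤ v → v ≤ b → (ψ v - ψ u) ^ ν * (S.φ v - S.φ u) ^ S.lam ≤
      |A| ^ (κ - 1) * ((ψ v + S.φ v) - (ψ u + S.φ u)) := by
    intro u v e1 e2 e3
    have q : (ψ v - ψ u) + (S.φ v - S.φ u) ≤ |A| := by
      refine le_trans ?_ (le_abs_self _)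
      linarith [nψ a u le_rfl e1 (e2.trans e3), nψ v b (e1.trans e2) e3 le_rfl,
        nφ a u le_rfl e1 (e2.trans e3), nφ v b (e1.trans e2) e3 le_rfl]
    refine (rpow_mul_rpow_le (nψ u v e1 e2 e3) (nφ u v e1 e2 e3) q hν hl h1.le).trans_eq ?_
    ring
  have hloc : ∀ ε : ℝ, 0 < ε → ∃ η : ℝ, 0 < η ∧ ∀ u ξ v, a ≤ u → u ≤ ξ → ξ ≤ v → v ≤ b →
      v - u ≤ η → ‖J v - J u - G ξ (S.ω v - S.ω u)‖ ≤
        ε * ((ψ v + S.φ v) - (ψ u + S.φ u)) := by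
    intro ε hε
    set B : ℝ := (sewConst κ + 1) * c * |A| ^ (κ - 1) with hB
    have hB0 : 0 ≤ B := by positivity
    obtain ⟨η, hη, hs⟩ := S.small (ε / (B + 1)) (by positivity)
    refine ⟨η, hη, fun u ξ v e1 e2 e3 e4 e5 => ?_⟩
    set ρ := ε / (B + 1) with hρ
    have hρ0 : 0 < ρ := by positivity
    have e23 := e2.trans e3
    have hω' : ∀ s t, u ≤ s → s ≤ t → t ≤ v →
        ‖S.ω t - S.ω s‖ ≤ ρ * (S.φ t - S.φ s) ^ S.lam := fun s t r1 r2 r3 =>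
      (hs s t (ha.trans (e1.trans r1)) r2 (r3.trans (e4.trans hb)) (by linarith)).1
    have s1 := hJ u v e1 e23 e4 (c * ρ) (by positivity) (defect u v ρ hρ0.le e1 e4 hω')
    rw [hwκ u v e1 e23 e4] at s1
    have s2 : ‖(G ξ - G u) (S.ω v - S.ω u)‖ ≤
        c * ρ * ((ψ v - ψ u) ^ ν * (S.φ v - S.φ u) ^ S.lam) := by
      refine (ContinuousLinearMap.le_opNorm _ _).trans ?_
      have m1 := nψ u ξ e1 e2 (e3.trans e4)
      have m2 := nψ ξ v (e1.trans e2) e3 e4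
      have q1 := Real.rpow_le_rpow m1 (by linarith : ψ ξ - ψ u ≤ ψ v - ψ u) hν.le
      have q2 := hG u ξ e1 e2 (e3.trans e4)
      have q3 := hω' u v le_rfl e23 le_rfl
      have q4 : ‖G ξ - G u‖ ≤ c * (ψ v - ψ u) ^ ν :=
        q2.trans (mul_le_mul_of_nonneg_left q1 hc)
      refine (mul_le_mul q4 q3 (norm_nonneg _) ((norm_nonneg _).trans q4)).trans_eq ?_
      ring
    have s3 : J v - J u - G ξ (S.ω v - S.ω u) =
        (J v - J u - G u (S.ω v - S.ω u)) - (G ξ - G u) (S.ω v - S.ω u) := by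
      rw [sub_apply]; abel
    have s4 := hmix u v e1 e23 e4
    have s5 : 0 ≤ (ψ v + S.φ v) - (ψ u + S.φ u) := by
      linarith [nψ u v e1 e23 e4, nφ u v e1 e23 e4]
    rw [s3]
    calc _ ≤ sewConst κ * (c * ρ) * ((ψ v - ψ u) ^ ν * (S.φ v - S.φ u) ^ S.lam) +
          c * ρ * ((ψ v - ψ u) ^ ν * (S.φ v - S.φ u) ^ S.lam) :=
          (norm_sub_le _ _).trans (add_le_add s1 s2)
      _ = (sewConst κ + 1) * c * ρ * ((ψ v - ψ u) ^ ν * (S.φ v - S.φ u) ^ S.lam) := by ring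
      _ ≤ (sewConst κ + 1) * c * ρ *
          (|A| ^ (κ - 1) * ((ψ v + S.φ v) - (ψ u + S.φ u))) := by gcongr
      _ = B * ρ * ((ψ v + S.φ v) - (ψ u + S.φ u)) := by rw [hB]; ring
      _ ≤ _ := by
          refine mul_le_mul_of_nonneg_right ?_ s5
          rw [hρ, ← mul_div_assoc, div_le_iff₀ (by positivity)]
          nlinarith
  have hψφ : MonotoneOn (fun r => ψ r + S.φ r) (Icc a b) := hψ.add hφ
  refine ⟨J, ⟨_, hψφ, fun ε hε => ?_⟩, fun u hu => ?_, ?_⟩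
  · obtain ⟨η, hη, h⟩ := hloc ε hε
    exact ⟨η, hη, fun u v e1 e2 e3 e4 => h u u v e1 le_rfl e2 e3 e4⟩
  · refine (isYoungIntegral_of_local hu.1 (hψφ.mono (Icc_subset_Icc le_rfl hu.2))
      fun ε hε => ?_).youngIntegral_eq hu.1
    obtain ⟨η, hη, h⟩ := hloc ε hε
    exact ⟨η, hη, fun s ξ t e1 e2 e3 e4 => h s ξ t e1 e2 e3 (e4.trans hu.2)⟩
  · refine ⟨sewConst κ * (c * S.cω) * |ψ b - ψ a| ^ ν,
      mul_nonneg (mul_nonneg hC (mul_nonneg hc S.cω_nonneg)) (by positivity),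
      fun u v e1 e2 e3 => ?_⟩
    have s1 := hJ u v e1 e2 e3 (c * S.cω) (mul_nonneg hc S.cω_nonneg)
      (defect u v S.cω S.cω_nonneg e1 e3 fun s t r1 r2 r3 =>
        S.norm_ω_sub_le s t (ha.trans (e1.trans r1)) r2 (r3.trans (e3.trans hb)))
    rw [hwκ u v e1 e2 e3] at s1
    refine s1.trans ?_
    have q := Real.rpow_le_rpow (nψ u v e1 e2 e3) (show ψ v - ψ u ≤ |ψ b - ψ a| by
      refine le_trans ?_ (le_abs_self _)
      linarith [nψ a u le_rfl e1 (e2.trans e3), nψ v b (e1.trans e2) e3 le_rfl]) hν.le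
    rw [mul_assoc (sewConst κ * (c * S.cω))]
    exact mul_le_mul_of_nonneg_left
      (mul_le_mul_of_nonneg_right q (Real.rpow_nonneg (nφ u v e1 e2 e3) _))
      (mul_nonneg hC (mul_nonneg hc S.cω_nonneg))

/-- Solutions of finite `q`-variation of the integral equation are solutions. -/
theorem isSol_of_youngIntegral {x : ℝ → Ed d} {z : Ed d} {a b q : ℝ} (ha : 0 ≤ a) (hab : a ≤ b)
    (hb : b ≤ S.T) (hq : 0 < q) (h1 : 1 < S.lam + 1 / q) (hx : ContinuousOn x (Icc a b))
    (hxq : FinitePVar q x a b)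
    (hxe : ∀ u ∈ Icc a b,
      x u = z + (∫ r in a..u, S.f r (x r)) + youngIntegral (fun r => S.g r (x r)) S.ω a u) :
    S.IsSol x a b := by
  obtain ⟨V, hV, hxV⟩ := hxq.exists_monotoneOn hq
  have hφ : MonotoneOn S.φ (Icc a b) := S.monotoneOn_φ.mono (Icc_subset_Icc ha hb)
  have hν : 0 < min (1 / q) S.mu := lt_min (one_div_pos.2 hq) S.mu_pos
  have hν1 : 1 < min (1 / q) S.mu + S.lam := by
    have := S.one_lt
    rcases min_choice (1 / q) S.mu with h | h <;> rw [h] <;> linarith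
  set ν := min (1 / q) S.mu with hνdef
  have nV : ∀ u v, a ≤ u → u ≤ v → v ≤ b → 0 ≤ V v - V u := fun u v e1 e2 e3 =>
    _root_.sub_nonneg.2 (hV ⟨e1, e2.trans e3⟩ ⟨e1.trans e2, e3⟩ e2)
  have nφ : ∀ u v, a ≤ u → u ≤ v → v ≤ b → 0 ≤ S.φ v - S.φ u := fun u v e1 e2 e3 =>
    S.sub_nonneg (ha.trans e1) e2 (e3.trans hb)
  set A : ℝ := (V b - V a) + (S.φ b - S.φ a) with hA
  have hA0 : 0 ≤ A := add_nonneg (nV a b le_rfl hab le_rfl) (nφ a b le_rfl hab le_rfl)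
  have hψA : ∀ u v, a ≤ u → u ≤ v → v ≤ b → (V v - V u) + (S.φ v - S.φ u) ≤ A := by
    intro u v e1 e2 e3
    linarith [nV a u le_rfl e1 (e2.trans e3), nV v b (e1.trans e2) e3 le_rfl,
        nφ a u le_rfl e1 (e2.trans e3), nφ v b (e1.trans e2) e3 le_rfl]
  have hL := S.Lg_nonneg
  have hcH := S.cH_nonneg
  obtain ⟨J, hJ, hJy, N, hN, hJN⟩ := S.exists_youngPrimitive (G := fun r => S.g r (x r))
    (ψ := fun r => V r + S.φ r) (c := S.Lg * A ^ (1 / q - ν) + S.cH * A ^ (S.mu - ν)) ha hb hν hν1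
    (by positivity) (hV.add hφ) (fun u v e1 e2 e3 => by
      have n1 := nV u v e1 e2 e3
      have n2 := nφ u v e1 e2 e3
      have e4 : ‖x v - x u‖ ≤ (V v - V u) ^ (1 / q) := by
        rw [one_div, Real.le_rpow_inv_iff_of_pos (norm_nonneg _) n1 hq]
        exact hxV u v e1 e2 e3
      have e5 := S.norm_g_path_sub_le (x := x) (ha.trans e1) e2 (e3.trans hb)
      have hs : V v + S.φ v - (V u + S.φ u) = (V v - V u) + (S.φ v - S.φ u) := by ring
      have n3 := add_nonneg n1 n2
      have e6 : ∀ y e, 0 ≤ y → y ≤ (V v - V u) + (S.φ v - S.φ u) → ν ≤ e →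
          y ^ e ≤ A ^ (e - ν) * ((V v - V u) + (S.φ v - S.φ u)) ^ ν := fun y e r1 r2 r3 =>
        (Real.rpow_le_rpow r1 r2 (hν.le.trans r3)).trans
          (rpow_le_rpow_sub_mul_rpow n3 (hψA u v e1 e2 e3) hν r3)
      rw [hs]
      have e7 := e6 _ (1 / q) n1 (le_add_of_nonneg_right n2) (min_le_left _ _)
      have e8 := e6 _ S.mu n2 (le_add_of_nonneg_left n1) (min_le_right _ _)
      calc _ ≤ _ := e5
        _ ≤ S.Lg * (A ^ (1 / q - ν) * ((V v - V u) + (S.φ v - S.φ u)) ^ ν) +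
            S.cH * (A ^ (S.mu - ν) * ((V v - V u) + (S.φ v - S.φ u)) ^ ν) := by
          gcongr; exact e4.trans e7
        _ = _ := by ring)
  have hinc : ∀ u v, a ≤ u → u ≤ v → v ≤ b →
      x v - x u = (∫ r in u..v, S.f r (x r)) + (J v - J u) := by
    intro u v e1 e2 e3
    rw [hxe v ⟨e1.trans e2, e3⟩, hxe u ⟨e1, e2.trans e3⟩, hJy v ⟨e1.trans e2, e3⟩,
      hJy u ⟨e1, e2.trans e3⟩, ← intervalIntegral.integral_add_adjacent_intervals
        (S.intervalIntegrable_f hx le_rfl e1 (e2.trans e3)) (S.intervalIntegrable_f hx e1 e2 e3)]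
    abel
  obtain ⟨R, hR⟩ := isCompact_Icc.exists_bound_of_continuousOn hx
  obtain ⟨F, hF, hfF⟩ := S.exists_bound S.continuous_f R
  obtain ⟨M, hM, hgM⟩ := S.exists_bound S.continuous_g R
  have hcω := S.cω_nonneg
  refine ⟨hx, ⟨F * S.cω + M * S.cω + N, by positivity, fun u v e1 e2 e3 => ?_⟩, J, hJ, hinc⟩
  have i1 : ‖∫ r in u..v, S.f r (x r)‖ ≤ F * (v - u) :=
    norm_integral_le e2 fun r r1 r2 => hfF r (x r) (ha.trans (e1.trans r1))
      (r2.trans (e3.trans hb)) (hR r ⟨e1.trans r1, r2.trans e3⟩)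
  have i2 := S.time_le u v (ha.trans e1) e2 (e3.trans hb)
  have i3 := S.norm_ω_sub_le u v (ha.trans e1) e2 (e3.trans hb)
  have i4 : ‖S.g u (x u) (S.ω v - S.ω u)‖ ≤ M * (S.cω * (S.φ v - S.φ u) ^ S.lam) :=
    (ContinuousLinearMap.le_opNorm _ _).trans (mul_le_mul
      (hgM u (x u) (ha.trans e1) (e2.trans (e3.trans hb)) (hR u ⟨e1, e2.trans e3⟩)) i3
      (norm_nonneg _) hM)
  have i5 : x v - x u = (∫ r in u..v, S.f r (x r)) + (S.g u (x u) (S.ω v - S.ω u) +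
      (J v - J u - S.g u (x u) (S.ω v - S.ω u))) := by
    rw [hinc u v e1 e2 e3, add_sub_cancel]
  rw [i5]
  calc _ ≤ F * (v - u) + (M * (S.cω * (S.φ v - S.φ u) ^ S.lam) + N * (S.φ v - S.φ u) ^ S.lam) :=
        (norm_add_le _ _).trans (add_le_add i1 ((norm_add_le _ _).trans
          (add_le_add i4 (hJN u v e1 e2 e3))))
    _ ≤ F * (S.cω * (S.φ v - S.φ u) ^ S.lam) +
        (M * (S.cω * (S.φ v - S.φ u) ^ S.lam) + N * (S.φ v - S.φ u) ^ S.lam) := by gcongr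
    _ = _ := by ring

end YoungSystem

theorem le_mul_rpow_of_rpow_le {x p A w l ρ : ℝ} (hx : 0 ≤ x) (hp : 0 < p) (hA : 0 ≤ A)
    (hw : 0 ≤ w) (hl : 0 < l) (hlp : l * p < 1) (h : x ^ p ≤ A * w)
    (hρ : x ^ (1 - l * p) * A ^ l ≤ ρ) : x ≤ ρ * w ^ l := by
  have e1 : x ^ (l * p) ≤ A ^ l * w ^ l := by
    rw [mul_comm, Real.rpow_mul hx, ← Real.mul_rpow hA hw]
    exact Real.rpow_le_rpow (Real.rpow_nonneg hx p) h hl.le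
  calc x = x ^ (1 - l * p) * x ^ (l * p) := by
        rw [← Real.rpow_add_of_nonneg hx (by linarith) (by positivity), sub_add_cancel,
          Real.rpow_one]
    _ ≤ x ^ (1 - l * p) * (A ^ l * w ^ l) :=
        mul_le_mul_of_nonneg_left e1 (Real.rpow_nonneg hx _)
    _ = x ^ (1 - l * p) * A ^ l * w ^ l := by ring
    _ ≤ _ := mul_le_mul_of_nonneg_right hρ (Real.rpow_nonneg hw _)

theorem exists_pos_rpow_mul_le {e c ρ : ℝ} (he : 0 < e) (hc : 0 ≤ c) (hρ : 0 < ρ) :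
    ∃ σ : ℝ, 0 < σ ∧ ∀ x, 0 ≤ x → x ≤ σ → x ^ e * c ≤ ρ := by
  have h0 : 0 < ρ / (c + 1) := by positivity
  refine ⟨(ρ / (c + 1)) ^ (1 / e), Real.rpow_pos_of_pos h0 _, fun x hx hxσ => ?_⟩
  have h := Real.rpow_le_rpow hx hxσ he.le
  rw [← Real.rpow_mul h0.le, one_div_mul_cancel he.ne', Real.rpow_one] at h
  calc _ ≤ ρ / (c + 1) * c := mul_le_mul_of_nonneg_right h hc
    _ ≤ ρ := by
      rw [div_mul_eq_mul_div, div_le_iff₀ (by positivity)]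
      nlinarith

theorem exists_youngSystem {d m : ℕ} {p β δ Lg T lam : ℝ} (hp : 1 ≤ p)
    {f : ℝ → Ed d → Ed d} {g : ℝ → Ed d → (Ed m →L[ℝ] Ed d)}
    (hf : Continuous (fun pr : ℝ × Ed d => f pr.1 pr.2))
    (hg : Continuous (fun pr : ℝ × Ed d => g pr.1 pr.2))
    {Dg : ℝ → Ed d → (Ed d →L[ℝ] Ed m →L[ℝ] Ed d)}
    (hDg : ∀ (t : ℝ) (x : Ed d), HasFDerivAt (g t) (Dg t x) x)
    (hβ : 0 < β) (hδ0 : 0 < δ) (hδ1 : δ ≤ 1) (hLg : 0 ≤ Lg)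
    {h : ℝ → ℝ → ℝ} (hctrl : IsControlOn 0 T h)
    (hgx : ∀ (t : ℝ) (x y : Ed d), ‖g t x - g t y‖ ≤ Lg * ‖x - y‖)
    (hDgx : ∀ R : ℝ, 0 ≤ R → ∃ M : ℝ, 0 ≤ M ∧ ∀ t x y, ‖x‖ ≤ R → ‖y‖ ≤ R →
      ‖Dg t x - Dg t y‖ ≤ M * ‖x - y‖ ^ δ)
    (hgt : ∀ s t : ℝ, s < t → ∀ x : Ed d,
      ‖g t x - g s x‖ + ‖Dg t x - Dg s x‖ ≤ h s t ^ β)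
    (hfx : ∀ R : ℝ, 0 ≤ R → ∃ L : ℝ, 0 ≤ L ∧ ∀ t x y, ‖x‖ ≤ R → ‖y‖ ≤ R →
      ‖f t x - f t y‖ ≤ L * ‖x - y‖)
    {ω : ℝ → Ed m} (hω : Continuous ω) (hωp : FinitePVar p ω 0 T) (hT : 0 < T)
    (hlam : 0 < lam) (hlp : lam * p < 1) (hlβ : 1 < lam + β) (hlδ : 1 < lam + lam * δ) :
    ∃ S : YoungSystem d m, S.f = f ∧ S.g = g ∧ S.ω = ω ∧ S.T = T ∧ S.lam = lam := by
  have hp0 : 0 < p := by linarith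
  obtain ⟨V, hV, hωV⟩ := hωp.exists_monotoneOn hp0
  obtain ⟨-, -, hsup, hnn⟩ := hctrl
  have hl1 : lam * 1 < 1 := lt_of_le_of_lt (mul_le_mul_of_nonneg_left hp hlam.le) hlp
  have nV : ∀ s t, 0 ≤ s → s ≤ t → t ≤ T → 0 ≤ V t - V s := fun s t h1 h2 h3 =>
    sub_nonneg.2 (hV ⟨h1, h2.trans h3⟩ ⟨h1.trans h2, h3⟩ h2)
  have nh : ∀ s t, 0 ≤ s → s ≤ t → t ≤ T → h s t ≤ h 0 t - h 0 s := fun s t h1 h2 h3 => by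
    linarith [hsup 0 s t le_rfl h1 h2 h3]
  set A : ℝ := 1 + ((V T - V 0) + T + (h 0 T - h 0 0)) with hA
  have hA1 : 1 ≤ A := by
    linarith [nV 0 T le_rfl hT.le le_rfl, nh 0 T le_rfl hT.le le_rfl, hnn 0 T le_rfl hT.le le_rfl]
  have hA0 : 0 < A := by linarith
  set φ : ℝ → ℝ := fun t => (V t + t + h 0 t) / A with hφ
  have hφA : ∀ s t, A * (φ t - φ s) = (V t - V s) + (t - s) + (h 0 t - h 0 s) := fun s t => by
    simp only [hφ]
    field_simp
    ring
  have hωφ : ∀ s t, 0 ≤ s → s ≤ t → t ≤ T → ‖ω t - ω s‖ ^ p ≤ A * (φ t - φ s) :=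
    fun s t h1 h2 h3 => by
      rw [hφA]
      linarith [hωV s t h1 h2 h3, nh s t h1 h2 h3, hnn s t h1 h2 h3]
  have htφ : ∀ s t, 0 ≤ s → s ≤ t → t ≤ T → (t - s) ^ (1 : ℝ) ≤ A * (φ t - φ s) :=
    fun s t h1 h2 h3 => by
      rw [hφA, Real.rpow_one]
      linarith [nV s t h1 h2 h3, nh s t h1 h2 h3, hnn s t h1 h2 h3]
  have hhφ : ∀ s t, 0 ≤ s → s ≤ t → t ≤ T → h s t ≤ A * (φ t - φ s) :=
    fun s t h1 h2 h3 => by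
      rw [hφA]
      linarith [nV s t h1 h2 h3, nh s t h1 h2 h3]
  have nφ : ∀ s t, 0 ≤ s → s ≤ t → t ≤ T → 0 ≤ φ t - φ s := fun s t h1 h2 h3 =>
    nonneg_of_mul_nonneg_right ((hnn s t h1 h2 h3).trans (hhφ s t h1 h2 h3)) hA0
  have hφmono : MonotoneOn φ (Icc 0 T) := fun s hs t ht hst => by
    linarith [nφ s t hs.1 hst ht.2]
  have hφT : φ T - φ 0 ≤ 1 := by
    have := hφA 0 T
    rw [← mul_le_mul_iff_right₀ hA0, this]
    linarith
  have hφ1 : ∀ s t, 0 ≤ s → s ≤ t → t ≤ T → φ t - φ s ≤ 1 := fun s t h1 h2 h3 => by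
    linarith [nφ 0 s le_rfl h1 (h2.trans h3), nφ t T (h1.trans h2) h3 le_rfl]
  have hmu : 0 < min β (lam * δ) := lt_min hβ (by positivity)
  have htime : ∀ s t, 0 ≤ s → s ≤ t → t ≤ T → ∀ x, ‖g t x - g s x‖ + ‖Dg t x - Dg s x‖ ≤
      A ^ β * (φ t - φ s) ^ min β (lam * δ) := by
    intro s t h1 h2 h3 x
    have n0 := nφ s t h1 h2 h3
    rcases eq_or_lt_of_le h2 with rfl | hlt
    · have e1 : ‖g s x - g s x‖ = 0 := norm_eq_zero.2 (sub_self _)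
      have e2 : ‖Dg s x - Dg s x‖ = 0 := by
        rw [sub_self (Dg s x)]
        exact ContinuousLinearMap.opNorm_zero
      rw [e1, e2, add_zero]
      exact mul_nonneg (Real.rpow_nonneg hA0.le _) (Real.rpow_nonneg n0 _)
    · calc _ ≤ h s t ^ β := hgt s t hlt x
        _ ≤ (A * (φ t - φ s)) ^ β :=
          Real.rpow_le_rpow (hnn s t h1 h2 h3) (hhφ s t h1 h2 h3) hβ.le
        _ = A ^ β * (φ t - φ s) ^ β := Real.mul_rpow hA0.le n0
        _ ≤ _ := mul_le_mul_of_nonneg_left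
          (Real.rpow_le_rpow_of_exponent_ge' n0 (hφ1 s t h1 h2 h3) hmu.le (min_le_left _ _))
          (Real.rpow_nonneg hA0.le _)
  obtain ⟨B, hB⟩ := (isCompact_Icc (a := 0) (b := T)).exists_bound_of_continuousOn hω.continuousOn
  have hB0 : 0 ≤ B := (norm_nonneg _).trans (hB 0 ⟨le_rfl, hT.le⟩)
  have hωB : ∀ s t, 0 ≤ s → s ≤ t → t ≤ T → ‖ω t - ω s‖ ≤ 2 * B := fun s t h1 h2 h3 => by
    linarith [norm_sub_le (ω t) (ω s), hB s ⟨h1, h2.trans h3⟩, hB t ⟨h1.trans h2, h3⟩]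
  have huc := (isCompact_Icc (a := (0 : ℝ)) (b := T)).uniformContinuousOn_of_continuous
    hω.continuousOn
  exact ⟨{
    f := f, g := g, Dg := Dg, ω := ω, φ := φ, T := T, lam := lam, mu := min β (lam * δ)
    δ := δ, Lg := Lg, cH := A ^ β
    cω := max ((2 * B) ^ (1 - lam * p) * A ^ lam) (T ^ (1 - lam * 1) * A ^ lam)
    continuous_f := hf
    continuous_g := hg
    hasFDerivAt_g := hDg
    Lg_nonneg := hLg
    cω_nonneg := le_max_of_le_left (by positivity)
    cH_nonneg := by positivity
    norm_g_sub_le := hgx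
    holder_Dg := hDgx
    lipschitz_f := hfx
    lam_pos := hlam
    mu_pos := hmu
    mu_le_lam := (min_le_right _ _).trans (by nlinarith)
    mu_le_lam_mul := min_le_right _ _
    one_lt := by rcases min_choice β (lam * δ) with h | h <;> rw [h] <;> assumption
    δ_pos := hδ0
    monotoneOn_φ := hφmono
    φ_total := hφT
    time_g := fun s t h1 h2 h3 x => by linarith [htime s t h1 h2 h3 x, norm_nonneg (Dg t x - Dg s x)]
    time_Dg := fun s t h1 h2 h3 x => by linarith [htime s t h1 h2 h3 x, norm_nonneg (g t x - g s x)]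
    norm_ω_sub_le := fun s t h1 h2 h3 =>
      le_mul_rpow_of_rpow_le (norm_nonneg _) hp0 hA0.le (nφ s t h1 h2 h3) hlam hlp
        (hωφ s t h1 h2 h3) (le_max_of_le_left (mul_le_mul_of_nonneg_right
          (Real.rpow_le_rpow (norm_nonneg _) (hωB s t h1 h2 h3) (by linarith))
          (Real.rpow_nonneg hA0.le _)))
    time_le := fun s t h1 h2 h3 =>
      le_mul_rpow_of_rpow_le (sub_nonneg.2 h2) one_pos hA0.le (nφ s t h1 h2 h3) hlam hl1
        (htφ s t h1 h2 h3) (le_max_of_le_right (mul_le_mul_of_nonneg_right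
          (Real.rpow_le_rpow (sub_nonneg.2 h2) (by linarith) (by linarith))
          (Real.rpow_nonneg hA0.le _)))
    small := fun ρ hρ => by
      obtain ⟨σ₁, hσ₁, h₁⟩ := exists_pos_rpow_mul_le (sub_pos.2 hlp)
        (Real.rpow_nonneg hA0.le lam) hρ
      obtain ⟨σ₂, hσ₂, h₂⟩ := exists_pos_rpow_mul_le (sub_pos.2 hl1)
        (Real.rpow_nonneg hA0.le lam) hρ
      obtain ⟨η, hη, h₃⟩ := Metric.uniformContinuousOn_iff.1 huc σ₁ hσ₁
      refine ⟨min (η / 2) σ₂, by positivity, fun s t h1 h2 h3 h4 => ⟨?_, ?_⟩⟩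
      · refine le_mul_rpow_of_rpow_le (norm_nonneg _) hp0 hA0.le (nφ s t h1 h2 h3) hlam hlp
          (hωφ s t h1 h2 h3) (h₁ _ (norm_nonneg _) ?_)
        rw [← dist_eq_norm]
        refine (h₃ t ⟨h1.trans h2, h3⟩ s ⟨h1, h2.trans h3⟩ ?_).le
        rw [Real.dist_eq, abs_of_nonneg (sub_nonneg.2 h2)]
        linarith [min_le_left (η / 2) σ₂]
      · exact le_mul_rpow_of_rpow_le (sub_nonneg.2 h2) one_pos hA0.le (nφ s t h1 h2 h3) hlam hl1
          (htφ s t h1 h2 h3) (h₂ _ (sub_nonneg.2 h2) (h4.trans (min_le_right _ _))) },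
    rfl, rfl, rfl, rfl, rfl⟩

namespace YoungSystem

variable {d m : ℕ} (S : YoungSystem d m)

/-- The Cauchy operators form a flow of homeomorphisms. -/
theorem isFlow (hT : 0 ≤ S.T) {X : ℝ → ℝ → Ed d → Ed d}
    (hfwd : ∀ s t : ℝ, 0 ≤ s → s ≤ t → t ≤ S.T → ∀ z : Ed d, ∃ x : ℝ → Ed d,
      S.IsSol x s t ∧ x s = z ∧ X s t z = x t)
    (hbwd : ∀ s t : ℝ, 0 ≤ t → t ≤ s → s ≤ S.T → ∀ z : Ed d,
      X s t (X t s z) = z ∧ X t s (X s t z) = z) :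
    (∀ s ∈ Icc (0 : ℝ) S.T, ∀ t ∈ Icc (0 : ℝ) S.T, IsHomeomorph (X s t)) ∧
    (∀ s ∈ Icc (0 : ℝ) S.T, X s s = id) ∧
    (∀ s ∈ Icc (0 : ℝ) S.T, ∀ t ∈ Icc (0 : ℝ) S.T, ∀ z : Ed d,
      X t s (X s t z) = z ∧ X s t (X t s z) = z) ∧
    (∀ s ∈ Icc (0 : ℝ) S.T, ∀ t ∈ Icc (0 : ℝ) S.T, ∀ u ∈ Icc (0 : ℝ) S.T, ∀ z : Ed d,
      X u t (X s u z) = X s t z) ∧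
    ContinuousOn (fun pr : ℝ × ℝ × Ed d => X pr.1 pr.2.1 pr.2.2)
      (Icc 0 S.T ×ˢ Icc 0 S.T ×ˢ univ) := by
  have hinv : ∀ s ∈ Icc (0 : ℝ) S.T, ∀ t ∈ Icc (0 : ℝ) S.T, ∀ z : Ed d,
      X t s (X s t z) = z := by
    intro s hs t ht z
    rcases le_total s t with hst | hts
    · exact (hbwd t s hs.1 hst ht.2 z).1
    · exact (hbwd s t ht.1 hts hs.2 z).2
  have hflow : ∀ y : ℝ → Ed d, S.IsSol y 0 S.T → ∀ s ∈ Icc (0 : ℝ) S.T, ∀ t ∈ Icc (0 : ℝ) S.T,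
      X s t (y s) = y t := by
    intro y hy
    have hle : ∀ s ∈ Icc (0 : ℝ) S.T, ∀ t ∈ Icc (0 : ℝ) S.T, s ≤ t → X s t (y s) = y t := by
      intro s hs t ht hst
      obtain ⟨x, hx, hxs, hxt⟩ := hfwd s t hs.1 hst ht.2 (y s)
      rw [hxt]
      exact hx.eqOn hs.1 ht.2 (hy.mono_set hs.1 ht.2) ⟨le_rfl, hst⟩ hxs ⟨hst, le_rfl⟩
    intro s hs t ht
    rcases le_total s t with hst | hts
    · exact hle s hs t ht hst
    · rw [← hle t ht s hs hts]
      exact hinv t ht s hs _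
  have hglob : ∀ s ∈ Icc (0 : ℝ) S.T, ∀ z : Ed d, ∃ y, S.IsSol y 0 S.T ∧ y s = z := by
    intro s hs z
    have h0 : (0 : ℝ) ∈ Icc 0 S.T := ⟨le_rfl, hT⟩
    obtain ⟨y, hy, hy0, -⟩ := hfwd 0 S.T le_rfl hT le_rfl (X s 0 z)
    exact ⟨y, hy, by rw [← hflow y hy 0 h0 s hs, hy0, hinv s hs 0 h0]⟩
  have hcont : ContinuousOn (fun pr : ℝ × ℝ × Ed d => X pr.1 pr.2.1 pr.2.2)
      (Icc 0 S.T ×ˢ Icc 0 S.T ×ˢ univ) := by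
    rintro ⟨s₀, t₀, z₀⟩ ⟨hs₀, ht₀, -⟩
    simp only at hs₀ ht₀
    obtain ⟨x, hx, hxs⟩ := hglob s₀ hs₀ z₀
    obtain ⟨R, hR, hxR⟩ := hx.exists_bound
    obtain ⟨K, hK, hstab⟩ := S.exists_stability hR
    set D := Icc (0 : ℝ) S.T ×ˢ Icc (0 : ℝ) S.T ×ˢ (univ : Set (Ed d)) with hD
    have c1 : ContinuousWithinAt (fun pr : ℝ × ℝ × Ed d => x pr.1) D (s₀, t₀, z₀) :=
      (hx.continuousOn s₀ hs₀).comp (t := Icc 0 S.T) continuous_fst.continuousWithinAt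
        fun pr hpr => hpr.1
    have c2 : ContinuousWithinAt (fun pr : ℝ × ℝ × Ed d => x pr.2.1) D (s₀, t₀, z₀) :=
      (hx.continuousOn t₀ ht₀).comp (t := Icc 0 S.T) (f := fun pr : ℝ × ℝ × Ed d => pr.2.1)
        (continuous_fst.comp continuous_snd).continuousWithinAt fun pr hpr => hpr.2.1
    have c3 : ContinuousWithinAt (fun pr : ℝ × ℝ × Ed d => K * ‖x pr.1 - pr.2.2‖) D
        (s₀, t₀, z₀) :=
      ((c1.sub (continuous_snd.comp continuous_snd).continuousWithinAt).norm).const_mul K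
    have c3' : Filter.Tendsto (fun pr : ℝ × ℝ × Ed d => K * ‖x pr.1 - pr.2.2‖)
        (nhdsWithin (s₀, t₀, z₀) D) (nhds 0) := by
      have := c3.tendsto
      simpa only [hxs, sub_self, norm_zero, mul_zero] using this
    have key : ∀ᶠ pr in nhdsWithin (s₀, t₀, z₀) D,
        dist (x pr.2.1) (X pr.1 pr.2.1 pr.2.2) ≤ K * ‖x pr.1 - pr.2.2‖ := by
      filter_upwards [self_mem_nhdsWithin, c3'.eventually_lt_const one_pos]
      rintro ⟨s, t, z⟩ ⟨hs, ht, -⟩ hlt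
      simp only at hs ht hlt ⊢
      obtain ⟨y, hy, rfl⟩ := hglob s hs z
      rw [hflow y hy s hs t ht, dist_eq_norm]
      exact hstab x y 0 S.T le_rfl le_rfl hx hy hxR s t hs ht hlt
    have c4 : Filter.Tendsto (fun pr : ℝ × ℝ × Ed d =>
        dist (x pr.2.1) (X pr.1 pr.2.1 pr.2.2)) (nhdsWithin (s₀, t₀, z₀) D) (nhds 0) :=
      squeeze_zero' (Filter.Eventually.of_forall fun _ => dist_nonneg) key c3'
    have c5 := (tendsto_iff_of_dist c4).1 c2.tendsto
    have hX : X s₀ t₀ z₀ = x t₀ := by rw [← hxs, hflow x hx s₀ hs₀ t₀ ht₀]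
    change Filter.Tendsto _ _ (nhds (X s₀ t₀ z₀))
    rwa [hX]
  have hcontX : ∀ s ∈ Icc (0 : ℝ) S.T, ∀ t ∈ Icc (0 : ℝ) S.T, Continuous (X s t) :=
    fun s hs t ht => hcont.comp_continuous (f := fun z : Ed d => (s, t, z)) (by fun_prop)
      fun z => ⟨hs, ht, mem_univ z⟩
  refine ⟨fun s hs t ht => ?_, fun s hs => ?_, fun s hs t ht z =>
    ⟨hinv s hs t ht z, hinv t ht s hs z⟩, fun s hs t ht u hu z => ?_, hcont⟩
  · exact isHomeomorph_iff_exists_inverse.2 ⟨hcontX s hs t ht, X t s, hinv s hs t ht,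
      hinv t ht s hs, hcontX t ht s hs⟩
  · funext z
    obtain ⟨y, hy, rfl⟩ := hglob s hs z
    exact hflow y hy s hs s hs
  · obtain ⟨y, hy, rfl⟩ := hglob s hs z
    rw [hflow y hy s hs u hu, hflow y hy u hu t ht, hflow y hy s hs t ht]

end YoungSystem

end YoungEquation


/-- Theorem `thm.flow`, two-parameter flow: under (H1)–(H3) holding on
every interval with constants independent of the interval, and `ω ∈ C̃^p(ℝ,ℝ^m)`, fix
`T > 0` and let `X s t : ℝ^d → ℝ^d` be the Cauchy operator for `s ≤ t` (mapping the initial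
value at time `s` to the value at time `t` of the unique solution), with `X s t := (X t s)⁻¹`
for `s > t`. Then the family `X s t`, `s,t ∈ [0,T]`, is a two-parameter flow of
homeomorphisms of `ℝ^d`: each `X s t` is a homeomorphism, `X s s = id`,
`X s t = (X t s)⁻¹`, `X s t = X u t ∘ X s u`, and `(s,t,z) ↦ X s t z` is continuous. -/
theorem stmt19
    {d m : ℕ} (p : ℝ) (hp1 : 1 < p) (hp2 : p < 2)
    (f : ℝ → Ed d → Ed d) (g : ℝ → Ed d → (Ed m →L[ℝ] Ed d))
    (hf : Continuous (fun pr : ℝ × Ed d => f pr.1 pr.2))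
    (hg : Continuous (fun pr : ℝ × Ed d => g pr.1 pr.2))
    (Dg : ℝ → Ed d → (Ed d →L[ℝ] Ed m →L[ℝ] Ed d))
    (hDg : ∀ (t : ℝ) (x : Ed d), HasFDerivAt (g t) (Dg t x) x)
    (β δ Lg : ℝ) (hβ0 : 0 < β) (hβ1 : β ≤ 1) (hδ0 : 0 < δ) (hδ1 : δ ≤ 1) (hLg : 0 < Lg)
    (h : ℝ → ℝ → ℝ) (hctrl : ∀ S T1 : ℝ, S ≤ T1 → IsControlOn S T1 h)
    (MN : ℝ → ℝ) (hMN : ∀ N : ℝ, 0 ≤ N → 0 < MN N)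
    (H1i : ∀ (t : ℝ) (x y : Ed d), ‖g t x - g t y‖ ≤ Lg * ‖x - y‖)
    (H1ii : ∀ N : ℝ, 0 ≤ N → ∀ (t : ℝ) (x y : Ed d), ‖x‖ ≤ N → ‖y‖ ≤ N →
      ‖Dg t x - Dg t y‖ ≤ MN N * ‖x - y‖ ^ δ)
    (H1iii : ∀ s t : ℝ, s < t → ∀ x : Ed d,
      ‖g t x - g s x‖ + ‖Dg t x - Dg s x‖ ≤ h s t ^ β)
    (a α : ℝ) (b : ℝ → ℝ) (ha : 0 < a) (hα1 : 1 / 2 ≤ α) (hα2 : α < 1)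
    (hbmem : ∀ S T1 : ℝ, S ≤ T1 →
      IntervalIntegrable (fun s => |b s| ^ (1 / (1 - α))) MeasureTheory.volume S T1)
    (LN : ℝ → ℝ) (hLN : ∀ N : ℝ, 0 ≤ N → 0 < LN N)
    (H2i : ∀ N : ℝ, 0 ≤ N → ∀ (t : ℝ) (x y : Ed d), ‖x‖ ≤ N → ‖y‖ ≤ N →
      ‖f t x - f t y‖ ≤ LN N * ‖x - y‖)
    (H2ii : ∀ (t : ℝ) (x : Ed d), ‖f t x‖ ≤ a * ‖x‖ + b t)
    (H3a : p - 1 < δ) (H3b : 1 - 1 / p < β) (H3c : 1 - 1 / p < δ * α)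
    (q0 q : ℝ)
    (hq0a : 1 - 1 / p < 1 / q0)
    (hq0b : 1 / q0 < min (min β (δ * α)) (min (δ / p) (1 / 2)))
    (hqa : 1 / (q0 * δ) ≤ 1 / q) (hqb : 1 / q < min α (1 / p))
    (ω : ℝ → Ed m) (hω : Continuous ω)
    (hωp : ∀ s t : ℝ, s ≤ t → FinitePVar p ω s t)
    (T : ℝ) (hT : 0 < T)
    (X : ℝ → ℝ → Ed d → Ed d)
    (hfwd : ∀ s t : ℝ, 0 ≤ s → s ≤ t → t ≤ T → ∀ z : Ed d, ∃ x : ℝ → Ed d,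
      ContinuousOn x (Set.Icc s t) ∧ FinitePVar q x s t ∧ x s = z ∧
      (∀ u ∈ Set.Icc s t,
        x u = z + (∫ r in s..u, f r (x r)) + youngIntegral (fun r => g r (x r)) ω s u) ∧
      X s t z = x t)
    (hbwd : ∀ s t : ℝ, 0 ≤ t → t ≤ s → s ≤ T → ∀ z : Ed d,
      X s t (X t s z) = z ∧ X t s (X s t z) = z) :
    (∀ s ∈ Set.Icc (0:ℝ) T, ∀ t ∈ Set.Icc (0:ℝ) T, IsHomeomorph (X s t)) ∧
    (∀ s ∈ Set.Icc (0:ℝ) T, X s s = id) ∧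
    (∀ s ∈ Set.Icc (0:ℝ) T, ∀ t ∈ Set.Icc (0:ℝ) T, ∀ z : Ed d,
      X t s (X s t z) = z ∧ X s t (X t s z) = z) ∧
    (∀ s ∈ Set.Icc (0:ℝ) T, ∀ t ∈ Set.Icc (0:ℝ) T, ∀ u ∈ Set.Icc (0:ℝ) T, ∀ z : Ed d,
      X u t (X s u z) = X s t z) ∧
    ContinuousOn (fun pr : ℝ × ℝ × Ed d => X pr.1 pr.2.1 pr.2.2)
      (Set.Icc 0 T ×ˢ Set.Icc 0 T ×ˢ Set.univ) := by
  have hp0 : 0 < p := by linarith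
  have hq0pos : 0 < 1 / q0 := by
    refine lt_trans ?_ hq0a
    rw [sub_pos, div_lt_one hp0]
    exact hp1
  have hqq : 1 / q0 ≤ 1 / q := by
    refine le_trans ?_ hqa
    rw [one_div_pos] at hq0pos
    exact one_div_le_one_div_of_le (by positivity) (mul_le_of_le_one_right hq0pos.le hδ1)
  have hq : 0 < q := one_div_pos.1 (hq0pos.trans_le hqq)
  have hδp : 1 / (1 + δ) < 1 / p := one_div_lt_one_div_of_lt hp0 (by linarith)
  obtain ⟨lam, hl1, hl2⟩ := exists_between (show
    max (max (1 - β) (1 / (1 + δ))) (1 - 1 / q) < 1 / p from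
      max_lt (max_lt (by linarith) hδp) (by linarith))
  have hlδ0 : 1 / (1 + δ) < lam := ((le_max_right _ _).trans (le_max_left _ _)).trans_lt hl1
  have hlβ : 1 - β < lam := ((le_max_left _ _).trans (le_max_left _ _)).trans_lt hl1
  have hlq : 1 - 1 / q < lam := (le_max_right _ _).trans_lt hl1
  have hlam : 0 < lam := lt_trans (by positivity) hlδ0
  rw [div_lt_iff₀ (by positivity)] at hlδ0
  rw [lt_div_iff₀ hp0] at hl2
  obtain ⟨S, rfl, rfl, rfl, rfl, rfl⟩ := exists_youngSystem hp1.le hf hg hDg hβ0 hδ0 hδ1 hLg.le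
    (hctrl 0 T hT.le) H1i (fun R hR => ⟨MN R, (hMN R hR).le, H1ii R hR⟩) H1iii
    (fun R hR => ⟨LN R, (hLN R hR).le, H2i R hR⟩) hω (hωp 0 T hT.le) hT hlam hl2
    (by linarith) (by linarith)
  exact S.isFlow hT.le (X := X) (fun s t h1 h2 h3 z => by
    obtain ⟨x, e1, e2, e3, e4, e5⟩ := hfwd s t h1 h2 h3 z
    exact ⟨x, S.isSol_of_youngIntegral h1 h2 h3 hq (by linarith) e1 e2 e4, e3, e5⟩) hbwd
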